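/- arXiv:0708.2539 — 2 statements merged into one kernel-verified Lean document; each statement's English description precedes it below -/
import Mathlib

section
/- There exists a constant c > 0 such that for all sufficiently large real x, the number of positive integers n ≤ x that can be written as n = 2^p + q with p a prime and q ∈ P₂* is at least c·x. In other words, the sumset 2^𝒫 + P₂* has positive lower asymptotic density. -/
open scoped Classical

/-- `P₂*`: all primes together with all products `p₁ * p₂` of primes with `p₁² < p₂`. -/
def P2star (n : ℕ) : Prop :=
  n.Prime ∨ ∃ p q : ℕ, p.Prime ∧ q.Prime ∧ p ^ 2 < q ∧ n = p * q

/-- Averages of functions with coprime periods are independent. -/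
theorem sum_range_mul_of_coprime {m n : ℕ} (hmn : m.Coprime n) (hm : 0 < m) (hn : 0 < n)
    {F H : ℕ → ℝ} (hF : Function.Periodic F m) (hH : Function.Periodic H n) :
    ∑ t ∈ Finset.range (m * n), F t * H t =
      (∑ t ∈ Finset.range m, F t) * ∑ t ∈ Finset.range n, H t := by
  rw [Finset.sum_mul_sum, ← Finset.sum_product']
  have hmaps : Set.MapsTo (fun t => (t % m, t % n)) (Finset.range (m * n) : Set ℕ)
      (Finset.range m ×ˢ Finset.range n : Finset (ℕ × ℕ)) := by
    intro t _
    simp [Nat.mod_lt _ hm, Nat.mod_lt _ hn]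
  have hinj : Set.InjOn (fun t => (t % m, t % n)) (Finset.range (m * n) : Set ℕ) := by
    intro t ht u hu h
    simp only [Finset.coe_range, Set.mem_Iio] at ht hu
    obtain ⟨h1, h2⟩ := Prod.mk.inj h
    have := (Nat.modEq_and_modEq_iff_modEq_mul hmn).1 ⟨h1, h2⟩
    exact Nat.ModEq.eq_of_lt_of_lt this ht hu
  refine Finset.sum_nbij (fun t => (t % m, t % n)) hmaps hinj ?_ ?_
  · exact Finset.surjOn_of_injOn_of_card_le _ hmaps hinj (by simp)
  · intro t _
    simp only [hF.map_mod_nat, hH.map_mod_nat]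

theorem periodic_prod {s : Finset ℕ} {f : ℕ → ℕ → ℝ} (hf : ∀ l ∈ s, Function.Periodic (f l) l) :
    Function.Periodic (fun t => ∏ l ∈ s, f l t) (∏ l ∈ s, l) := by
  intro t
  refine Finset.prod_congr rfl fun l hl => ?_
  obtain ⟨k, hk⟩ := Finset.dvd_prod_of_mem (fun l => l) hl
  rw [hk, mul_comm]
  exact (hf l hl).nat_mul k t

/-- Over a full period, a product of functions with distinct prime periods sums to the product of
the sums. -/
theorem sum_range_prod_primes {s : Finset ℕ} (hs : ∀ l ∈ s, l.Prime) {f : ℕ → ℕ → ℝ}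
    (hf : ∀ l ∈ s, Function.Periodic (f l) l) :
    ∑ t ∈ Finset.range (∏ l ∈ s, l), ∏ l ∈ s, f l t =
      ∏ l ∈ s, ∑ t ∈ Finset.range l, f l t := by
  induction s using Finset.induction_on with
  | empty => simp
  | insert p s hp ih =>
    have hs' : ∀ l ∈ s, l.Prime := fun l hl => hs l (Finset.mem_insert_of_mem hl)
    have hf' : ∀ l ∈ s, Function.Periodic (f l) l := fun l hl => hf l (Finset.mem_insert_of_mem hl)
    have hpp := hs p (Finset.mem_insert_self _ _)
    simp only [Finset.prod_insert hp]
    rw [← ih hs' hf']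
    refine sum_range_mul_of_coprime ?_ hpp.pos (Finset.prod_pos fun l hl => (hs' l hl).pos)
      (hf p (Finset.mem_insert_self _ _)) (periodic_prod hf')
    refine Nat.Coprime.prod_right fun l hl => (Nat.coprime_primes hpp (hs' l hl)).2 ?_
    rintro rfl
    exact hp hl

/-- The sum of a bounded periodic function over an initial segment. -/
theorem sum_range_le_of_periodic {F : ℕ → ℝ} {q : ℕ} (hq : 0 < q) (hF : Function.Periodic F q)
    {B : ℝ} (hB : ∀ t, |F t| ≤ B) (N : ℕ) :
    ∑ t ∈ Finset.range N, F t ≤ N / q * ∑ t ∈ Finset.range q, F t + 2 * q * B := by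
  have hB0 : 0 ≤ B := (abs_nonneg _).trans (hB 0)
  have hsum : ∀ k : ℕ, ∀ r : ℕ, ∑ t ∈ Finset.range (q * k + r), F t =
      k * ∑ t ∈ Finset.range q, F t + ∑ t ∈ Finset.range r, F t := by
    intro k r
    rw [Finset.sum_range_add]
    congr 1
    · induction k with
      | zero => simp
      | succ k ih =>
        rw [mul_add, mul_one, Finset.sum_range_add, ih]
        push_cast
        rw [add_mul, one_mul]
        congr 1
        refine Finset.sum_congr rfl fun t _ => ?_
        rw [add_comm, mul_comm]
        exact hF.nat_mul k t
    · refine Finset.sum_congr rfl fun t _ => ?_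
      rw [add_comm, mul_comm]
      exact hF.nat_mul k t
  have hbound : ∀ r : ℕ, |∑ t ∈ Finset.range r, F t| ≤ r * B := fun r => by
    refine (Finset.abs_sum_le_sum_abs _ _).trans ?_
    refine (Finset.sum_le_sum fun t _ => hB t).trans ?_
    simp
  have hq' : (0 : ℝ) < q := by exact_mod_cast hq
  have h1 := hsum (N / q) (N % q)
  rw [Nat.div_add_mod] at h1
  rw [h1]
  have hr : ((N % q : ℕ) : ℝ) ≤ q := by exact_mod_cast (Nat.mod_lt N hq).le
  have hN : (N : ℝ) = q * (N / q : ℕ) + (N % q : ℕ) := by exact_mod_cast (Nat.div_add_mod N q).symm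
  have hr1 := (abs_le.1 (hbound (N % q))).2
  have hr2 := (abs_le.1 (hbound q)).1
  have h3 : ((N % q : ℕ) : ℝ) / q ≤ 1 := (div_le_one hq').2 hr
  have h4 : (0 : ℝ) ≤ ((N % q : ℕ) : ℝ) / q := by positivity
  have h5 : (N : ℝ) / q = (N / q : ℕ) + ((N % q : ℕ) : ℝ) / q := by
    rw [hN]; field_simp; 
  rw [h5, add_mul]
  have h6 : -(q * B) ≤ ((N % q : ℕ) : ℝ) / q * ∑ t ∈ Finset.range q, F t := by
    nlinarith [mul_nonneg hq'.le hB0]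
  nlinarith [mul_le_mul_of_nonneg_right hr hB0]

/-- Selberg's upper bound sieve, in the form of an approximate Bessel inequality. -/
theorem selberg_sieve {Q : Finset ℕ} (hQ : ∀ l ∈ Q, l.Prime) {𝒮 : Finset (Finset ℕ)}
    (h𝒮 : ∀ s ∈ 𝒮, s ⊆ Q) {R : ℕ} (hR : ∀ s ∈ 𝒮, ∏ l ∈ s, l ≤ R)
    {f : ℕ → ℕ → ℝ} {g : ℕ → ℝ} (hper : ∀ l ∈ Q, Function.Periodic (f l) l)
    (hf0 : ∀ l ∈ Q, ∑ t ∈ Finset.range l, f l t = 0)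
    (hfsq : ∀ l ∈ Q, g l * ∑ t ∈ Finset.range l, f l t ^ 2 = l)
    (hfb : ∀ l ∈ Q, ∀ t, |f l t| ≤ l) (hg : ∀ l ∈ Q, 0 < g l)
    {N : ℕ} {Z : Finset ℕ} (hZN : Z ⊆ Finset.range N) (hZ : ∀ t ∈ Z, ∀ l ∈ Q, f l t = 1)
    (hG : 0 < ∑ s ∈ 𝒮, ∏ l ∈ s, g l) :
    (Z.card : ℝ) ≤ N / (∑ s ∈ 𝒮, ∏ l ∈ s, g l) + 2 * R ^ 4 := by
  set G := ∑ s ∈ 𝒮, ∏ l ∈ s, g l with hGdef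
  have hgs : ∀ s ∈ 𝒮, 0 < ∏ l ∈ s, g l := fun s hs =>
    Finset.prod_pos fun l hl => hg l (h𝒮 s hs hl)
  have hFb : ∀ s ∈ 𝒮, ∀ t, |∏ l ∈ s, f l t| ≤ R := fun s hs t => by
    rw [Finset.abs_prod]
    calc ∏ l ∈ s, |f l t| ≤ ∏ l ∈ s, (l : ℝ) :=
          Finset.prod_le_prod (fun _ _ => abs_nonneg _) fun l hl => hfb l (h𝒮 s hs hl) t
      _ ≤ R := by
          rw [← Nat.cast_prod]
          exact_mod_cast hR s hs
  have hpair : ∀ s ∈ 𝒮, ∀ s' ∈ 𝒮,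
      (∏ l ∈ s, g l) * (∏ l ∈ s', g l) *
        ∑ t ∈ Finset.range N, (∏ l ∈ s, f l t) * ∏ l ∈ s', f l t ≤
      (if s = s' then N * ∏ l ∈ s, g l else 0) +
        (∏ l ∈ s, g l) * (∏ l ∈ s', g l) * (2 * R ^ 4) := by
    intro s hs s' hs'
    have hsu : ∀ l ∈ s ∪ s', l ∈ Q := fun l hl =>
      (Finset.mem_union.1 hl).elim (fun h => h𝒮 s hs h) fun h => h𝒮 s' hs' h
    have hF : Function.Periodic (fun t => (∏ l ∈ s, f l t) * ∏ l ∈ s', f l t)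
        (∏ l ∈ s ∪ s', l) := by
      intro t
      have key : ∀ s₁ ⊆ s ∪ s', ∏ l ∈ s₁, f l (t + ∏ l ∈ s ∪ s', l) = ∏ l ∈ s₁, f l t := by
        intro s₁ h₁
        refine Finset.prod_congr rfl fun l hl => ?_
        obtain ⟨k, hk⟩ := Finset.dvd_prod_of_mem (fun l => l) (h₁ hl)
        rw [hk, mul_comm]
        exact (hper l (hsu l (h₁ hl))).nat_mul k t
      simp only [key s Finset.subset_union_left, key s' Finset.subset_union_right]
    have hq : 0 < ∏ l ∈ s ∪ s', l := Finset.prod_pos fun l hl => (hQ l (hsu l hl)).pos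
    have hqR : ((∏ l ∈ s ∪ s', l : ℕ) : ℝ) ≤ R ^ 2 := by
      have h1 : (∏ l ∈ s ∪ s', l) ≤ (∏ l ∈ s, l) * ∏ l ∈ s', l := by
        rw [← Finset.prod_union_inter]
        refine Nat.le_mul_of_pos_right _ (Finset.prod_pos fun l hl => ?_)
        exact (hQ l (h𝒮 s hs (Finset.mem_inter.1 hl).1)).pos
      have h2 := h1.trans (Nat.mul_le_mul (hR s hs) (hR s' hs'))
      rw [sq]; exact_mod_cast h2
    have hb : ∀ t, |(∏ l ∈ s, f l t) * ∏ l ∈ s', f l t| ≤ (R : ℝ) ^ 2 := fun t => by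
      rw [abs_mul, sq]
      exact mul_le_mul (hFb s hs t) (hFb s' hs' t) (abs_nonneg _) (by positivity)
    have hmain := sum_range_le_of_periodic hq hF hb N
    have hgg := mul_pos (hgs s hs) (hgs s' hs')
    have hfull : ∑ t ∈ Finset.range (∏ l ∈ s ∪ s', l), (∏ l ∈ s, f l t) * ∏ l ∈ s', f l t =
        if s = s' then ∏ l ∈ s, ∑ t ∈ Finset.range l, f l t ^ 2 else 0 := by
      split_ifs with h
      · subst h
        rw [Finset.union_self, ← sum_range_prod_primes (fun l hl => hQ l (h𝒮 s hs hl))]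
        · refine Finset.sum_congr rfl fun t _ => ?_
          rw [← Finset.prod_mul_distrib]
          simp only [sq]
        · intro l hl t
          simp only [hper l (h𝒮 s hs hl) t]
      · have h2 : ∀ t, (∏ l ∈ s, f l t) * ∏ l ∈ s', f l t =
            ∏ l ∈ s ∪ s', (if l ∈ s then f l t else 1) * (if l ∈ s' then f l t else 1) := by
          intro t
          rw [Finset.prod_mul_distrib, Finset.prod_ite_mem, Finset.prod_ite_mem,
            Finset.union_inter_cancel_left, Finset.union_inter_cancel_right]
        simp only [h2]
        rw [sum_range_prod_primes (fun l hl => hQ l (hsu l hl))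
          (f := fun l t => (if l ∈ s then f l t else 1) * (if l ∈ s' then f l t else 1))]
        · obtain ⟨l, hl⟩ : ∃ l, ¬ (l ∈ s ↔ l ∈ s') := by
            by_contra hcon
            push Not at hcon
            exact h (Finset.ext hcon)
          have hlu : l ∈ s ∪ s' := by
            rw [Finset.mem_union]; tauto
          refine Finset.prod_eq_zero hlu ?_
          rw [← hf0 l (hsu l hlu)]
          refine Finset.sum_congr rfl fun t _ => ?_
          by_cases h1 : l ∈ s <;> by_cases h3 : l ∈ s' <;> simp_all
        · intro l hl t
          simp only [hper l (hsu l hl) t]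
    rw [hfull] at hmain
    have herr : 2 * ((∏ l ∈ s ∪ s', l : ℕ) : ℝ) * (R : ℝ) ^ 2 ≤ 2 * R ^ 4 := by
      have : (0 : ℝ) ≤ R ^ 2 := by positivity
      nlinarith
    refine (mul_le_mul_of_nonneg_left (hmain.trans (add_le_add_right herr _)) hgg.le).trans ?_
    rw [mul_add]
    refine add_le_add_left (le_of_eq ?_) _
    split_ifs with h
    · subst h
      have hsq : (∏ l ∈ s, g l) * ∏ l ∈ s, ∑ t ∈ Finset.range l, f l t ^ 2 =
          ((∏ l ∈ s, l : ℕ) : ℝ) := by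
        rw [← Finset.prod_mul_distrib]
        push_cast
        exact Finset.prod_congr rfl fun l hl => hfsq l (h𝒮 s hs hl)
      have hne : ((∏ l ∈ s, l : ℕ) : ℝ) ≠ 0 := by
        rw [Finset.union_self] at hq
        exact_mod_cast hq.ne'
      rw [Finset.union_self]
      calc _ = (N : ℝ) / ((∏ l ∈ s, l : ℕ) : ℝ) * (∏ l ∈ s, g l) *
            ((∏ l ∈ s, g l) * ∏ l ∈ s, ∑ t ∈ Finset.range l, f l t ^ 2) := by ring
        _ = _ := by rw [hsq]; field_simp
    · ring
  have hupper : ∑ t ∈ Finset.range N, (∑ s ∈ 𝒮, (∏ l ∈ s, g l) * ∏ l ∈ s, f l t) ^ 2 ≤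
      N * G + G ^ 2 * (2 * R ^ 4) := by
    calc ∑ t ∈ Finset.range N, (∑ s ∈ 𝒮, (∏ l ∈ s, g l) * ∏ l ∈ s, f l t) ^ 2
        = ∑ s ∈ 𝒮, ∑ s' ∈ 𝒮, (∏ l ∈ s, g l) * (∏ l ∈ s', g l) *
            ∑ t ∈ Finset.range N, (∏ l ∈ s, f l t) * ∏ l ∈ s', f l t := by
          simp only [sq, Finset.sum_mul_sum]
          simp only [Finset.mul_sum]
          rw [Finset.sum_comm]
          refine Finset.sum_congr rfl fun s _ => ?_
          rw [Finset.sum_comm]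
          refine Finset.sum_congr rfl fun s' _ => Finset.sum_congr rfl fun t _ => by ring
      _ ≤ ∑ s ∈ 𝒮, ∑ s' ∈ 𝒮, ((if s = s' then N * ∏ l ∈ s, g l else 0) +
            (∏ l ∈ s, g l) * (∏ l ∈ s', g l) * (2 * R ^ 4)) :=
          Finset.sum_le_sum fun s hs => Finset.sum_le_sum fun s' hs' => hpair s hs s' hs'
      _ = N * G + G ^ 2 * (2 * R ^ 4) := by
          simp only [Finset.sum_add_distrib, Finset.sum_ite_eq]
          rw [hGdef, sq, Finset.sum_mul_sum, Finset.mul_sum, Finset.sum_mul]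
          congr 1
          · exact Finset.sum_congr rfl fun s hs => by simp [hs]
          · exact Finset.sum_congr rfl fun s _ => by rw [Finset.sum_mul]
  have hlower : (Z.card : ℝ) * G ^ 2 ≤
      ∑ t ∈ Finset.range N, (∑ s ∈ 𝒮, (∏ l ∈ s, g l) * ∏ l ∈ s, f l t) ^ 2 := by
    calc (Z.card : ℝ) * G ^ 2 = ∑ t ∈ Z, G ^ 2 := by simp
      _ = ∑ t ∈ Z, (∑ s ∈ 𝒮, (∏ l ∈ s, g l) * ∏ l ∈ s, f l t) ^ 2 := by
          refine Finset.sum_congr rfl fun t ht => ?_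
          congr 1
          refine Finset.sum_congr rfl fun s hs => ?_
          rw [Finset.prod_eq_one fun l hl => hZ t ht l (h𝒮 s hs hl), mul_one]
      _ ≤ _ := Finset.sum_le_sum_of_subset_of_nonneg hZN fun _ _ _ => sq_nonneg _
  have h := hlower.trans hupper
  have hG2 : 0 < G ^ 2 := by positivity
  rw [← mul_le_mul_iff_left₀ hG2]
  refine h.trans (le_of_eq ?_)
  field_simp

theorem sum_le_sum_of_injOn_of_nonneg {α β : Type*} {s : Finset α} {t : Finset β} {f : α → ℝ}
    {g : β → ℝ} (i : α → β) (hi : Set.MapsTo i s t) (hinj : Set.InjOn i s)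
    (hfg : ∀ a ∈ s, f a ≤ g (i a)) (hg : ∀ b ∈ t, 0 ≤ g b) : ∑ a ∈ s, f a ≤ ∑ b ∈ t, g b := by
  calc ∑ a ∈ s, f a ≤ ∑ a ∈ s, g (i a) := Finset.sum_le_sum hfg
    _ = ∑ b ∈ s.image i, g b := (Finset.sum_image hinj).symm
    _ ≤ ∑ b ∈ t, g b := Finset.sum_le_sum_of_subset_of_nonneg
        (Finset.image_subset_iff.2 fun a ha => hi ha) fun b hb _ => hg b hb

/-- The sets of primes outside `E` whose product is at most `y`; these encode the squarefree
numbers up to `y` coprime to `E`. -/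
def primeSets (y : ℕ) (E : Finset ℕ) : Finset (Finset ℕ) :=
  (((Finset.range (y + 1)).filter Nat.Prime \ E).powerset).filter fun s => ∏ l ∈ s, l ≤ y

theorem mem_primeSets {y : ℕ} {E s : Finset ℕ} :
    s ∈ primeSets y E ↔ (∀ l ∈ s, l.Prime ∧ l ∉ E) ∧ ∏ l ∈ s, l ≤ y := by
  simp only [primeSets, Finset.mem_filter, Finset.mem_powerset, Finset.subset_iff,
    Finset.mem_sdiff, Finset.mem_range]
  constructor
  · rintro ⟨h, hy⟩
    exact ⟨fun l hl => ⟨(h hl).1.2, (h hl).2⟩, hy⟩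
  · rintro ⟨h, hy⟩
    refine ⟨fun l hl => ⟨⟨?_, (h l hl).1⟩, (h l hl).2⟩, hy⟩
    have : l ∣ ∏ l ∈ s, l := Finset.dvd_prod_of_mem (fun l => l) hl
    have := Nat.le_of_dvd (Finset.prod_pos fun l hl => (h l hl).1.pos) this
    omega

theorem log_le_mul_sum_primeSets (y : ℕ) (E : Finset ℕ) :
    Real.log y ≤ 2 * (∏ l ∈ E, (1 + (l : ℝ)⁻¹)) *
      ∑ s ∈ primeSets y E, ∏ l ∈ s, (l : ℝ)⁻¹ := by
  have hharm : Real.log y ≤ ∑ a ∈ Finset.Icc 1 y, (a : ℝ)⁻¹ := by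
    have h := log_add_one_le_harmonic y
    rw [harmonic_eq_sum_Icc] at h
    push_cast at h
    refine le_trans ?_ h
    rcases Nat.eq_zero_or_pos y with rfl | hy
    · simp
    · exact Real.log_le_log (by exact_mod_cast hy) (by linarith)
  refine hharm.trans ?_
  choose c b hbc hc using Nat.sq_mul_squarefree
  set T := Finset.Ioo 0 (y + 1) ×ˢ (E.powerset ×ˢ primeSets y E) with hT
  have key : ∑ a ∈ Finset.Icc 1 y, (a : ℝ)⁻¹ ≤ ∑ x ∈ T, ((x.1 : ℝ) ^ 2)⁻¹ *
      ((∏ l ∈ x.2.1, (l : ℝ)⁻¹) * ∏ l ∈ x.2.2, (l : ℝ)⁻¹) := by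
    refine sum_le_sum_of_injOn_of_nonneg
      (fun a => (b a, ((c a).primeFactors ∩ E, (c a).primeFactors \ E))) ?_ ?_ ?_ ?_
    · intro a ha
      rw [Finset.coe_Icc, Set.mem_Icc] at ha
      have hb0 : b a ≠ 0 := by
        intro h; have := hbc a; rw [h] at this; simp at this; omega
      have hc0 : 0 < c a := Nat.pos_of_ne_zero (hc a).ne_zero
      have hble : b a ≤ a := by
        conv_rhs => rw [← hbc a]
        exact (Nat.le_self_pow two_ne_zero _).trans (Nat.le_mul_of_pos_right _ hc0)
      have hcle : c a ≤ a := by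
        conv_rhs => rw [← hbc a]
        exact Nat.le_mul_of_pos_left _ (by positivity)
      simp only [hT, Finset.mem_coe, Finset.mem_product, Finset.mem_Ioo, Finset.mem_powerset,
        mem_primeSets]
      refine ⟨⟨by omega, by omega⟩, Finset.inter_subset_right, ?_, ?_⟩
      · intro l hl
        rw [Finset.mem_sdiff] at hl
        exact ⟨Nat.prime_of_mem_primeFactors hl.1, hl.2⟩
      · refine le_trans (le_trans (Nat.le_of_dvd ?_ ?_)
          (Nat.prod_primeFactors_of_squarefree (hc a)).le) (hcle.trans ha.2)
        · exact Finset.prod_pos fun l hl => (Nat.prime_of_mem_primeFactors hl).pos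
        · exact Finset.prod_dvd_prod_of_subset _ _ _ Finset.sdiff_subset
    · intro a _ a' _ h
      simp only [Prod.mk.injEq] at h
      have h2 : (c a).primeFactors = (c a').primeFactors := by
        ext l
        have h3 := Finset.ext_iff.1 h.2.1 l
        have h4 := Finset.ext_iff.1 h.2.2 l
        simp only [Finset.mem_inter, Finset.mem_sdiff] at h3 h4
        tauto
      rw [← hbc a, ← hbc a', h.1, ← Nat.prod_primeFactors_of_squarefree (hc a),
        ← Nat.prod_primeFactors_of_squarefree (hc a'), h2]
    · intro a _
      refine le_of_eq ?_
      have h1 : (∏ l ∈ (c a).primeFactors ∩ E, (l : ℝ)⁻¹) *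
          ∏ l ∈ (c a).primeFactors \ E, (l : ℝ)⁻¹ = ((c a : ℕ) : ℝ)⁻¹ := by
        rw [Finset.prod_inter_mul_prod_sdiff]
        conv_rhs => rw [← Nat.prod_primeFactors_of_squarefree (hc a)]
        push_cast
        rw [Finset.prod_inv_distrib]
      simp only
      rw [h1]
      conv_lhs => rw [← hbc a]
      push_cast
      rw [mul_inv]
    · intro x _
      positivity
  refine key.trans ?_
  rw [hT, Finset.sum_product]
  simp only [← Finset.mul_sum, Finset.sum_product]
  rw [← Finset.sum_mul, ← Finset.sum_mul, Finset.prod_one_add, ← mul_assoc]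
  have h2 := sum_Ioo_inv_sq_le (α := ℝ) 0 (y + 1)
  simp only [Nat.cast_zero, zero_add, div_one] at h2
  gcongr

theorem sq_sum_primeSets_le {y : ℕ} {E : Finset ℕ} (hE : 2 ∈ E) :
    (∑ s ∈ primeSets y E, ∏ l ∈ s, (l : ℝ)⁻¹) ^ 2 ≤
      ∑ s ∈ primeSets (y ^ 2) E, ∏ l ∈ s, (2 / ((l : ℝ) - 2)) := by
  have hmaps : ∀ x ∈ primeSets y E ×ˢ primeSets y E, x.1 ∪ x.2 ∈ primeSets (y ^ 2) E := by
    intro x hx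
    rw [Finset.mem_product, mem_primeSets, mem_primeSets] at hx
    rw [mem_primeSets]
    refine ⟨fun l hl => (Finset.mem_union.1 hl).elim (hx.1.1 l) (hx.2.1 l), ?_⟩
    have h1 : (∏ l ∈ x.1 ∪ x.2, l) ≤ (∏ l ∈ x.1, l) * ∏ l ∈ x.2, l := by
      rw [← Finset.prod_union_inter]
      refine Nat.le_mul_of_pos_right _ (Finset.prod_pos fun l hl => ?_)
      exact (hx.1.1 l (Finset.mem_inter.1 hl).1).1.pos
    rw [sq]
    exact h1.trans (Nat.mul_le_mul hx.1.2 hx.2.2)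
  rw [sq, Finset.sum_mul_sum, ← Finset.sum_product',
    ← Finset.sum_fiberwise_of_maps_to hmaps]
  refine Finset.sum_le_sum fun n hn => ?_
  rw [mem_primeSets] at hn
  calc ∑ x ∈ (primeSets y E ×ˢ primeSets y E).filter (fun x => x.1 ∪ x.2 = n),
        (∏ l ∈ x.1, (l : ℝ)⁻¹) * ∏ l ∈ x.2, (l : ℝ)⁻¹
      ≤ ∑ w ∈ n.powerset.sigma fun s => s.powerset,
          (∏ l ∈ n, (l : ℝ)⁻¹) * ∏ l ∈ w.2, (l : ℝ)⁻¹ := by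
        refine sum_le_sum_of_injOn_of_nonneg (fun x => ⟨x.1, x.1 ∩ x.2⟩) ?_ ?_ ?_ ?_
        · intro x hx
          rw [Finset.mem_coe, Finset.mem_filter] at hx
          rw [Finset.mem_coe, Finset.mem_sigma, Finset.mem_powerset, Finset.mem_powerset]
          exact ⟨hx.2 ▸ Finset.subset_union_left, Finset.inter_subset_left⟩
        · intro x hx x' hx' h
          rw [Finset.mem_coe, Finset.mem_filter] at hx hx'
          simp only [Sigma.mk.injEq, heq_eq_eq] at h
          have hu := hx.2.trans hx'.2.symm
          refine Prod.ext h.1 (Finset.ext fun l => ?_)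
          have h1 := Finset.ext_iff.1 hu l
          have h2 := Finset.ext_iff.1 h.2 l
          have h3 := Finset.ext_iff.1 h.1 l
          simp only [Finset.mem_union, Finset.mem_inter] at h1 h2
          tauto
        · intro x hx
          rw [Finset.mem_filter] at hx
          simp only
          rw [← hx.2, Finset.prod_union_inter]
        · intro w _
          positivity
    _ = ∏ l ∈ n, ((l : ℝ)⁻¹ * (1 + (1 + (l : ℝ)⁻¹))) := by
        rw [Finset.sum_sigma, Finset.prod_mul_distrib, Finset.prod_one_add]
        simp only [← Finset.mul_sum, Finset.prod_one_add]
    _ ≤ ∏ l ∈ n, (2 / ((l : ℝ) - 2)) := by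
        refine Finset.prod_le_prod (fun l _ => by positivity) fun l hl => ?_
        have hl2 : l ≠ 2 := fun h => (hn.1 l hl).2 (h ▸ hE)
        have hl3 : (3 : ℝ) ≤ l := by
          have := (hn.1 l hl).1.two_le
          exact_mod_cast (by omega : 3 ≤ l)
        have : (0 : ℝ) < l := by linarith
        rw [le_div_iff₀ (by linarith), inv_eq_one_div]
        field_simp
        nlinarith

theorem log_sq_le_mul_sum_primeSets {y : ℕ} (hy : 0 < y) {E : Finset ℕ} (hE : 2 ∈ E) :
    Real.log y ^ 2 ≤ 4 * (∏ l ∈ E, (1 + (l : ℝ)⁻¹) ^ 2) *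
      ∑ s ∈ primeSets (y ^ 2) E, ∏ l ∈ s, (2 / ((l : ℝ) - 2)) := by
  have h1 := log_le_mul_sum_primeSets y E
  have h0 : 0 ≤ Real.log y := Real.log_nonneg (by exact_mod_cast hy)
  have h2 := pow_le_pow_left₀ h0 h1 2
  refine h2.trans ?_
  rw [mul_pow, mul_pow, Finset.prod_pow]
  rw [show (2 : ℝ) ^ 2 = 4 by norm_num]
  gcongr
  exact sq_sum_primeSets_le hE

/-- The arithmetic factor `∏_{l ∣ n} (1 + 1/l)²` governing the number of prime pairs. -/
noncomputable def singularFactor (n : ℕ) : ℝ := ∏ l ∈ n.primeFactors, (1 + (l : ℝ)⁻¹) ^ 2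

theorem card_filter_dvd_linear {l u b : ℕ} (hl : l.Prime) (hb : ¬ l ∣ b) :
    ((Finset.range l).filter fun t => l ∣ u + b * t).card = 1 := by
  have := Fact.mk hl
  rw [Finset.card_eq_one]
  refine ⟨(-(u : ZMod l) / b).val, ?_⟩
  have hb' : (b : ZMod l) ≠ 0 := fun h => hb ((ZMod.natCast_eq_zero_iff _ _).1 h)
  ext t
  rw [Finset.mem_filter, Finset.mem_range, Finset.mem_singleton, ← ZMod.natCast_eq_zero_iff]
  push_cast
  constructor
  · rintro ⟨ht, h⟩
    have : (t : ZMod l) = -u / b := by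
      rw [eq_div_iff hb']
      linear_combination h
    rw [← this, ZMod.val_natCast_of_lt ht]
  · rintro rfl
    refine ⟨ZMod.val_lt _, ?_⟩
    rw [ZMod.natCast_zmod_val]
    field_simp
    ring

theorem card_filter_dvd_two_linear {l a b u v h : ℕ} (hl : l.Prime) (ha : ¬ l ∣ a) (hb : ¬ l ∣ b)
    (hh : ¬ l ∣ h) (huv : a * u = b * v + h) :
    ((Finset.range l).filter fun t => l ∣ u + b * t ∨ l ∣ v + a * t).card = 2 := by
  rw [Finset.filter_or, Finset.card_union_of_disjoint, card_filter_dvd_linear hl hb,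
    card_filter_dvd_linear hl ha]
  rw [Finset.disjoint_filter]
  intro t _ h1 h2
  apply hh
  rw [← Nat.dvd_add_right (h2.mul_left b)]
  have : b * (v + a * t) + h = a * (u + b * t) := by
    rw [mul_add, mul_add, huv]; ring
  rw [this]
  exact h1.mul_left a

theorem card_le_of_two_linear {a b u v h z N : ℕ} (ha : 0 < a) (hb : 0 < b) (hh : 0 < h)
    (hz : 2 ≤ z) (huv : a * u = b * v + h) {Z : Finset ℕ} (hZN : Z ⊆ Finset.range N)
    (hZ : ∀ t ∈ Z, ∀ l, l.Prime → l ≤ z ^ 2 → ¬ l ∣ u + b * t ∧ ¬ l ∣ v + a * t) :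
    (Z.card : ℝ) ≤ N * (4 * singularFactor (2 * a * b * h)) / Real.log z ^ 2 + 2 * z ^ 8 := by
  set E := (2 * a * b * h).primeFactors with hEdef
  have hne : 2 * a * b * h ≠ 0 := by positivity
  have hE2 : 2 ∈ E := by
    rw [hEdef, Nat.mem_primeFactors]
    exact ⟨Nat.prime_two, ⟨a * b * h, by ring⟩, hne⟩
  set Q := (Finset.range (z ^ 2 + 1)).filter Nat.Prime \ E with hQdef
  have hQ : ∀ l ∈ Q, l.Prime ∧ l ≤ z ^ 2 ∧ l ∉ E := by
    intro l hl
    rw [hQdef, Finset.mem_sdiff, Finset.mem_filter, Finset.mem_range] at hl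
    exact ⟨hl.1.2, by omega, hl.2⟩
  have hQ3 : ∀ l ∈ Q, (3 : ℝ) ≤ l := by
    intro l hl
    have h1 := (hQ l hl).1.two_le
    have h2 : l ≠ 2 := fun h => (hQ l hl).2.2 (h ▸ hE2)
    exact_mod_cast (by omega : 3 ≤ l)
  have hnd : ∀ l ∈ Q, ¬ l ∣ 2 * a * b * h := fun l hl hd =>
    (hQ l hl).2.2 (Nat.mem_primeFactors.2 ⟨(hQ l hl).1, hd, hne⟩)
  set f : ℕ → ℕ → ℝ := fun l t =>
    if l ∣ u + b * t ∨ l ∣ v + a * t then -((l - 2) / 2 : ℝ) else 1 with hf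
  have hcard : ∀ l ∈ Q,
      ((Finset.range l).filter fun t => l ∣ u + b * t ∨ l ∣ v + a * t).card = 2 := by
    intro l hl
    refine card_filter_dvd_two_linear (hQ l hl).1 (fun hd => hnd l hl ?_) (fun hd => hnd l hl ?_)
      (fun hd => hnd l hl ?_) huv
    · exact ((hd.mul_left 2).mul_right b).mul_right h
    · exact (hd.mul_left (2 * a)).mul_right h
    · exact hd.mul_left (2 * a * b)
  have hcard' : ∀ l ∈ Q, (((Finset.range l).filter
      fun t => ¬ (l ∣ u + b * t ∨ l ∣ v + a * t)).card : ℝ) = l - 2 := by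
    intro l hl
    have h1 := Finset.card_filter_add_card_filter_not (s := Finset.range l)
      (fun t => l ∣ u + b * t ∨ l ∣ v + a * t)
    rw [hcard l hl, Finset.card_range] at h1
    rw [eq_sub_iff_add_eq, add_comm]
    exact_mod_cast h1
  have hlog : 0 < Real.log z := Real.log_pos (by exact_mod_cast (by omega : 1 < z))
  have hGlow := log_sq_le_mul_sum_primeSets (y := z) (by omega) hE2
  set G := ∑ s ∈ primeSets (z ^ 2) E, ∏ l ∈ s, (2 / ((l : ℝ) - 2)) with hGdef
  have hS : 0 < ∏ l ∈ E, (1 + (l : ℝ)⁻¹) ^ 2 := Finset.prod_pos fun l _ => by positivity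
  have hG : 0 < G := by
    by_contra hcon
    push Not at hcon
    have : 0 < Real.log z ^ 2 := by positivity
    nlinarith
  have hmain := selberg_sieve (Q := Q) (fun l hl => (hQ l hl).1) (𝒮 := primeSets (z ^ 2) E)
    (R := z ^ 2) (f := f) (g := fun l => 2 / ((l : ℝ) - 2)) (N := N) (Z := Z) ?_ ?_ ?_ ?_ ?_ ?_ ?_
    hZN ?_ hG
  · refine hmain.trans ?_
    rw [← hGdef]
    have h8 : 2 * ((z ^ 2 : ℕ) : ℝ) ^ 4 = 2 * (z : ℝ) ^ 8 := by push_cast; ring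
    rw [h8]
    refine add_le_add_left ?_ _
    rw [div_le_div_iff₀ hG (by positivity), mul_assoc]
    exact mul_le_mul_of_nonneg_left hGlow (Nat.cast_nonneg N)
  · intro s hs
    exact Finset.mem_powerset.1 (Finset.mem_filter.1 hs).1
  · intro s hs
    exact (Finset.mem_filter.1 hs).2
  · intro l hl t
    simp only [hf]
    congr 1
    rw [mul_add, mul_add, ← add_assoc, ← add_assoc, Nat.dvd_add_left (Dvd.intro_left _ rfl),
      Nat.dvd_add_left (Dvd.intro_left _ rfl)]
  · intro l hl
    simp only [hf]
    rw [Finset.sum_ite, Finset.sum_const, Finset.sum_const, hcard l hl, nsmul_eq_mul, nsmul_eq_mul,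
      hcard' l hl]
    push_cast
    ring
  · intro l hl
    have hl3 := hQ3 l hl
    have h2 : (l : ℝ) - 2 ≠ 0 := by linarith
    simp only [hf, ite_pow]
    rw [Finset.sum_ite, Finset.sum_const, Finset.sum_const, hcard l hl, nsmul_eq_mul, nsmul_eq_mul,
      hcard' l hl]
    push_cast
    field_simp
    ring
  · intro l hl t
    have hl3 := hQ3 l hl
    simp only [hf]
    split_ifs
    · rw [abs_neg, abs_of_nonneg (by linarith)]
      linarith
    · rw [abs_one]; linarith
  · intro l hl
    have hl3 := hQ3 l hl
    exact div_pos two_pos (by linarith)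
  · intro t ht l hl
    have := hZ t ht l (hQ l hl).1 (hQ l hl).2.1
    simp only [hf]
    rw [if_neg (by tauto)]

/-- Sieve bound for the number of solutions of `a u = b v + h` in primes `u`, `v`. -/
theorem card_prime_solutions_le {a b h z U : ℕ} (ha : 0 < a) (hb : 0 < b) (hab : a.Coprime b)
    (hh : 0 < h) (hz : 2 ≤ z) :
    (((Finset.range U).filter fun u => u.Prime ∧ z ^ 2 < u ∧
      ∃ v, v.Prime ∧ z ^ 2 < v ∧ a * u = b * v + h).card : ℝ) ≤
      ((U : ℝ) / b + 1) * (4 * singularFactor (2 * a * b * h)) / Real.log z ^ 2 + 2 * z ^ 8 := by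
  set W := (Finset.range U).filter fun u => u.Prime ∧ z ^ 2 < u ∧
      ∃ v, v.Prime ∧ z ^ 2 < v ∧ a * u = b * v + h with hW
  have hS : 0 ≤ singularFactor (2 * a * b * h) := Finset.prod_nonneg fun l _ => by positivity
  rcases W.eq_empty_or_nonempty with hemp | hne
  · rw [hemp]
    simp only [Finset.card_empty, Nat.cast_zero]
    positivity
  set u := W.min' hne with hu
  have humem := W.min'_mem hne
  rw [← hu, hW, Finset.mem_filter, Finset.mem_range] at humem
  obtain ⟨huU, hup, huz, v, hvp, hvz, huv⟩ := humem
  have hpar : ∀ w ∈ W, ∃ t, w = u + b * t ∧ t < U / b + 1 ∧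
      ∀ l, l.Prime → l ≤ z ^ 2 → ¬ l ∣ u + b * t ∧ ¬ l ∣ v + a * t := by
    intro w hw
    have huw : u ≤ w := W.min'_le w hw
    rw [hW, Finset.mem_filter, Finset.mem_range] at hw
    obtain ⟨hwU, hwp, hwz, v', hvp', hvz', huv'⟩ := hw
    obtain ⟨d, rfl⟩ := Nat.exists_eq_add_of_le huw
    have hvv : v ≤ v' := by
      have h1 : a * u ≤ a * (u + d) := Nat.mul_le_mul_left a huw
      have : b * v ≤ b * v' := by omega
      exact Nat.le_of_mul_le_mul_left this hb
    obtain ⟨e, rfl⟩ := Nat.exists_eq_add_of_le hvv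
    have hde : a * d = b * e := by
      rw [mul_add, mul_add] at huv'
      omega
    have hbd : b ∣ d := hab.symm.dvd_of_dvd_mul_left ⟨e, hde⟩
    obtain ⟨t, rfl⟩ := hbd
    have het : e = a * t := by
      have : b * (a * t) = b * e := by rw [← hde]; ring
      exact (Nat.eq_of_mul_eq_mul_left hb this).symm
    subst het
    refine ⟨t, rfl, ?_, fun l hl hlz => ⟨fun hd => ?_, fun hd => ?_⟩⟩
    · rw [Nat.lt_succ_iff, Nat.le_div_iff_mul_le hb, mul_comm]
      omega
    · have := (Nat.prime_dvd_prime_iff_eq hl hwp).1 hd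
      omega
    · have := (Nat.prime_dvd_prime_iff_eq hl hvp').1 hd
      omega
  choose! τ hτ using hpar
  have hinj : Set.InjOn τ W := by
    intro w hw w' hw' hww
    rw [(hτ w hw).1, (hτ w' hw').1, hww]
  have hcard := card_le_of_two_linear (N := U / b + 1) (Z := W.image τ) ha hb hh hz huv ?_ ?_
  · rw [Finset.card_image_of_injOn hinj] at hcard
    refine hcard.trans ?_
    push_cast
    gcongr
    exact Nat.cast_div_le
  · intro t ht
    obtain ⟨w, hw, rfl⟩ := Finset.mem_image.1 ht
    exact Finset.mem_range.2 (hτ w hw).2.1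
  · intro t ht
    obtain ⟨w, hw, rfl⟩ := Finset.mem_image.1 ht
    exact (hτ w hw).2.2

theorem two_pow_card_le_prod {s : Finset ℕ} {n : ℕ} (hs : ∀ l ∈ s, n ≤ l) :
    n ^ s.card ≤ ∏ l ∈ s, l := by
  rw [← Finset.prod_const]
  exact Finset.prod_le_prod' hs

/-- A Mertens-type upper bound for the sum of the reciprocals of the primes. -/
theorem sum_inv_primes_le {J : ℕ} (hJ : 1 ≤ J) :
    ∑ l ∈ (Finset.range (2 ^ J + 1)).filter Nat.Prime, (l : ℝ)⁻¹ ≤ 5 + 4 * Real.log J := by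
  have hblock : ∀ j : ℕ, 1 ≤ j →
      ∑ l ∈ (Finset.Ico (2 ^ j + 1) (2 ^ (j + 1) + 1) : Finset ℕ).filter Nat.Prime, (l : ℝ)⁻¹ ≤ 4 / j := by
    intro j hj
    set B := (Finset.Ico (2 ^ j + 1) (2 ^ (j + 1) + 1) : Finset ℕ).filter Nat.Prime with hB
    have hBlow : ∀ l ∈ B, 2 ^ j ≤ l := fun l hl => by
      rw [hB, Finset.mem_filter, Finset.mem_Ico] at hl
      omega
    have h1 : (2 ^ j) ^ B.card ≤ 2 ^ (2 ^ (j + 2)) := by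
      calc (2 ^ j) ^ B.card ≤ ∏ l ∈ B, l := two_pow_card_le_prod hBlow
        _ ≤ primorial (2 ^ (j + 1)) := by
          rw [primorial]
          refine Finset.prod_le_prod_of_subset_of_one_le' ?_ ?_
          · intro l hl
            rw [hB, Finset.mem_filter, Finset.mem_Ico] at hl
            simp only [Finset.mem_filter, Finset.mem_range]
            exact ⟨hl.1.2, hl.2⟩
          · intro l hl _
            exact (Finset.mem_filter.1 hl).2.pos
        _ ≤ 4 ^ (2 ^ (j + 1)) := primorial_le_four_pow _
        _ = 2 ^ (2 ^ (j + 2)) := by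
          rw [show 4 = 2 ^ 2 by norm_num, ← pow_mul]
          congr 1
          ring
    rw [← pow_mul] at h1
    have h2 : j * B.card ≤ 2 ^ (j + 2) := (Nat.pow_le_pow_iff_right (by norm_num)).1 h1
    have h3 : ∑ l ∈ B, (l : ℝ)⁻¹ ≤ B.card * ((2 : ℝ) ^ j)⁻¹ := by
      rw [← nsmul_eq_mul]
      refine Finset.sum_le_card_nsmul _ _ _ fun l hl => ?_
      refine inv_anti₀ (by positivity) ?_
      exact_mod_cast hBlow l hl
    refine h3.trans ?_
    have hj' : (0 : ℝ) < j := by exact_mod_cast hj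
    rw [le_div_iff₀ hj', mul_assoc, mul_comm, mul_assoc, inv_mul_le_iff₀ (by positivity)]
    have : (j : ℝ) * B.card ≤ 2 ^ (j + 2) := by exact_mod_cast h2
    rw [pow_add] at this
    linarith
  have hind : ∑ l ∈ (Finset.range (2 ^ J + 1)).filter Nat.Prime, (l : ℝ)⁻¹ ≤
      1 + 4 * ∑ j ∈ Finset.range J, (j : ℝ)⁻¹ := by
    induction J, hJ using Nat.le_induction with
    | base =>
      have : (Finset.range (2 ^ 1 + 1)).filter Nat.Prime = {2} := by decide
      rw [this]
      norm_num
    | succ J hJ ih =>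
      rw [Finset.range_eq_Ico, ← Finset.Ico_union_Ico_eq_Ico (b := 2 ^ J + 1) (Nat.zero_le _)
        (Nat.add_le_add_right (Nat.pow_le_pow_right (by norm_num) (Nat.le_succ J)) 1),
        Finset.filter_union, Finset.sum_union (Finset.disjoint_filter_filter
          (Finset.Ico_disjoint_Ico_consecutive _ _ _)), ← Finset.range_eq_Ico,
        Finset.sum_range_succ]
      have hb := hblock J hJ
      rw [div_eq_mul_inv] at hb
      linarith
  have hh : ∑ j ∈ Finset.range J, (j : ℝ)⁻¹ ≤ 1 + Real.log J := by
    have h := harmonic_le_one_add_log J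
    rw [harmonic_eq_sum_Icc] at h
    push_cast at h
    refine le_trans ?_ h
    rw [← Finset.sum_filter_ne_zero]
    refine Finset.sum_le_sum_of_subset_of_nonneg (fun j hj => ?_) fun _ _ _ => by positivity
    rw [Finset.mem_filter, Finset.mem_range, ne_eq, inv_eq_zero, Nat.cast_eq_zero] at hj
    exact Finset.mem_Icc.2 ⟨by omega, hj.1.le⟩
  linarith

theorem prod_one_add_le_exp {s : Finset ℕ} {k : ℝ} (hk : 0 ≤ k) {B : ℝ}
    (hB : ∑ l ∈ s, (l : ℝ)⁻¹ ≤ B) : ∏ l ∈ s, (1 + k / l) ≤ Real.exp (k * B) := by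
  calc ∏ l ∈ s, (1 + k / (l : ℝ)) ≤ ∏ l ∈ s, Real.exp (k / l) :=
        Finset.prod_le_prod (fun l _ => by positivity) fun l _ => by
          rw [add_comm]; exact Real.add_one_le_exp _
    _ = Real.exp (k * ∑ l ∈ s, (l : ℝ)⁻¹) := by
        rw [← Real.exp_sum, Finset.mul_sum]
        simp only [div_eq_mul_inv]
    _ ≤ Real.exp (k * B) := Real.exp_le_exp.2 (mul_le_mul_of_nonneg_left hB hk)

theorem prod_primeFactors_one_add_le {N J : ℕ} (hJ : 1 ≤ J) (hN0 : N ≠ 0) (hN : N ≤ 2 ^ 2 ^ J)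
    (k : ℕ) : ∏ l ∈ N.primeFactors, (1 + (k : ℝ) / l) ≤ Real.exp (6 * k) * (J : ℝ) ^ (4 * k) := by
  have hJ0 : (0 : ℝ) < J := by exact_mod_cast hJ
  have hsum : ∑ l ∈ N.primeFactors, (l : ℝ)⁻¹ ≤ 6 + 4 * Real.log J := by
    rw [← Finset.sum_filter_add_sum_filter_not N.primeFactors (fun l => l < 2 ^ J + 1)]
    have h1 : ∑ l ∈ N.primeFactors.filter (fun l => l < 2 ^ J + 1), (l : ℝ)⁻¹ ≤
        5 + 4 * Real.log J := by
      refine le_trans (Finset.sum_le_sum_of_subset_of_nonneg ?_ ?_) (sum_inv_primes_le hJ)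
      · intro l hl
        rw [Finset.mem_filter] at hl ⊢
        exact ⟨Finset.mem_range.2 hl.2, Nat.prime_of_mem_primeFactors hl.1⟩
      · intro l _ _
        positivity
    have hcard : N.primeFactors.card ≤ 2 ^ J := by
      have h2 : 2 ^ N.primeFactors.card ≤ 2 ^ 2 ^ J := by
        refine le_trans (two_pow_card_le_prod fun l hl => ?_)
          ((Nat.le_of_dvd (Nat.pos_of_ne_zero hN0) (Nat.prod_primeFactors_dvd N)).trans hN)
        exact (Nat.prime_of_mem_primeFactors hl).two_le
      exact (Nat.pow_le_pow_iff_right (by norm_num)).1 h2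
    have h3 : ∑ l ∈ N.primeFactors.filter (fun l => ¬ l < 2 ^ J + 1), (l : ℝ)⁻¹ ≤ 1 := by
      calc _ ≤ (N.primeFactors.filter (fun l => ¬ l < 2 ^ J + 1)).card • ((2 : ℝ) ^ J)⁻¹ := by
            refine Finset.sum_le_card_nsmul _ _ _ fun l hl => ?_
            rw [Finset.mem_filter] at hl
            refine inv_anti₀ (by positivity) ?_
            exact_mod_cast (by omega : 2 ^ J ≤ l)
        _ ≤ (2 : ℝ) ^ J * ((2 : ℝ) ^ J)⁻¹ := by
            rw [nsmul_eq_mul]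
            gcongr
            exact_mod_cast (Finset.card_filter_le _ _).trans hcard
        _ = 1 := mul_inv_cancel₀ (by positivity)
    linarith
  refine (prod_one_add_le_exp (Nat.cast_nonneg k) hsum).trans (le_of_eq ?_)
  rw [show (k : ℝ) * (6 + 4 * Real.log J) = 6 * k + ((4 * k : ℕ) : ℝ) * Real.log J by
    push_cast; ring, Real.exp_add, Real.exp_nat_mul, Real.exp_log hJ0]

theorem sum_prod_primeFactors_eq (k : ℝ) {A : ℕ → ℕ} (T Q : Finset ℕ)
    (hA : ∀ m ∈ T, (A m).primeFactors ⊆ Q) :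
    ∑ m ∈ T, ∏ l ∈ (A m).primeFactors, (1 + k / l) =
      ∑ s ∈ Q.powerset, (∏ l ∈ s, k / l) * (T.filter fun m => s ⊆ (A m).primeFactors).card := by
  have h : ∀ m ∈ T, ∏ l ∈ (A m).primeFactors, (1 + k / l) =
      ∑ s ∈ Q.powerset, if s ⊆ (A m).primeFactors then ∏ l ∈ s, k / l else 0 := by
    intro m hm
    rw [Finset.prod_one_add, ← Finset.sum_filter]
    refine Finset.sum_congr (Finset.ext fun s => ?_) fun _ _ => rfl
    rw [Finset.mem_filter, Finset.mem_powerset, Finset.mem_powerset]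
    exact ⟨fun hs => ⟨hs.trans (hA m hm), hs⟩, fun hs => hs.2⟩
  rw [Finset.sum_congr rfl h, Finset.sum_comm]
  refine Finset.sum_congr rfl fun s _ => ?_
  rw [← Finset.sum_filter, Finset.sum_const, nsmul_eq_mul, mul_comm]

theorem card_filter_dvd_Icc_le (e M : ℕ) :
    (((Finset.Icc 1 M).filter fun m => e ∣ m).card : ℝ) ≤ (M : ℝ) / e := by
  have : (Finset.Icc 1 M) = Finset.Ioc 0 M := rfl
  rw [this, Nat.Ioc_filter_dvd_card_eq_div]
  exact Nat.cast_div_le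

theorem prod_dvd_of_subset_primeFactors {s : Finset ℕ} {n : ℕ} (hs : s ⊆ n.primeFactors) :
    ∏ l ∈ s, l ∣ n :=
  (Finset.prod_dvd_prod_of_subset _ _ _ hs).trans (Nat.prod_primeFactors_dvd n)

theorem sum_prod_primeFactors_le (k M : ℕ) :
    ∑ m ∈ Finset.Icc 1 M, ∏ l ∈ m.primeFactors, (1 + (k : ℝ) / l) ≤ Real.exp (2 * k) * M := by
  set Q := Finset.Ioo 0 (M + 1) with hQ
  change ∑ m ∈ Finset.Icc 1 M, ∏ l ∈ (id m).primeFactors, (1 + (k : ℝ) / l) ≤ _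
  rw [sum_prod_primeFactors_eq k (A := id) (Finset.Icc 1 M) Q]
  · calc _ ≤ ∑ s ∈ Q.powerset, (M : ℝ) * ∏ l ∈ s, ((k : ℝ) * ((l : ℝ) ^ 2)⁻¹) := by
          refine Finset.sum_le_sum fun s hs => ?_
          have h1 : (((Finset.Icc 1 M).filter fun m => s ⊆ (id m).primeFactors).card : ℝ) ≤
              (M : ℝ) / (∏ l ∈ s, l : ℕ) := by
            refine le_trans ?_ (card_filter_dvd_Icc_le _ M)
            exact_mod_cast Finset.card_le_card (Finset.monotone_filter_right _
              fun m _ hm => prod_dvd_of_subset_primeFactors hm)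
          have h2 : (0 : ℝ) ≤ ∏ l ∈ s, ((k : ℝ) / l) := Finset.prod_nonneg fun _ _ => by positivity
          refine (mul_le_mul_of_nonneg_left h1 h2).trans (le_of_eq ?_)
          push_cast
          rw [div_eq_mul_inv (M : ℝ), ← Finset.prod_inv_distrib, mul_left_comm,
            ← Finset.prod_mul_distrib]
          congr 1
          refine Finset.prod_congr rfl fun l _ => ?_
          rw [div_eq_mul_inv, sq, mul_inv, mul_assoc]
      _ = M * ∏ l ∈ Q, (1 + (k : ℝ) * ((l : ℝ) ^ 2)⁻¹) := by
          rw [← Finset.mul_sum, Finset.prod_one_add]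
      _ ≤ M * ∏ l ∈ Q, Real.exp (k * ((l : ℝ) ^ 2)⁻¹) := by
          gcongr with l hl
          rw [add_comm]; exact Real.add_one_le_exp _
      _ ≤ M * Real.exp (2 * k) := by
          rw [← Real.exp_sum, ← Finset.mul_sum]
          have h2 := sum_Ioo_inv_sq_le (α := ℝ) 0 (M + 1)
          simp only [Nat.cast_zero, zero_add, div_one] at h2
          rw [mul_comm 2]
          gcongr
      _ = _ := mul_comm _ _
  · intro m hm l hl
    rw [Finset.mem_Icc] at hm
    rw [hQ, Finset.mem_Ioo]
    have := Nat.le_of_mem_primeFactors hl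
    have := (Nat.prime_of_mem_primeFactors hl).pos
    simp only [id] at *
    omega

/-- Romanov's theorem on the average of `∏ (1 + k/l)` over the prime factors of `2 ^ m - 1`. -/
theorem exists_sum_prod_primeFactors_two_pow_sub_one_le (k : ℕ) :
    ∃ C : ℝ, ∀ M : ℕ, ∑ m ∈ Finset.Icc 1 M, ∏ l ∈ (2 ^ m - 1 : ℕ).primeFactors, (1 + (k : ℝ) / l) ≤
      C * M := by
  set β : ℕ → ℝ := fun j => Real.exp (6 * k) * ((2 * j + 2 : ℕ) : ℝ) ^ (4 * k) * (1 / 2) ^ j with hβ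
  have hβ0 : ∀ j, 0 ≤ β j := fun j => by simp only [hβ]; positivity
  have hsum : Summable β := by
    have h1 : Summable fun j : ℕ => ((j : ℝ) ^ (4 * k)) * (1 / 2 : ℝ) ^ j :=
      summable_pow_mul_geometric_of_norm_lt_one _ (by norm_num)
    have h2 := (summable_nat_add_iff 1).2 h1
    refine (h2.mul_left (Real.exp (6 * k) * 2 ^ (4 * k) * 2)).congr fun j => ?_
    simp only [hβ]
    rw [show 2 * j + 2 = 2 * (j + 1) by ring]
    push_cast
    rw [mul_pow, pow_succ (1 / 2 : ℝ) j]
    ring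
  refine ⟨∑' j, β j, fun M => ?_⟩
  set Q := Finset.range (2 ^ M) with hQ
  set w : Finset ℕ → ℝ := fun s => ∏ l ∈ s, ((k : ℝ) / l) with hw
  have hw0 : ∀ s, 0 ≤ w s := fun s => Finset.prod_nonneg fun _ _ => by positivity
  set e : Finset ℕ → ℕ := fun s => orderOf (2 : ZMod (∏ l ∈ s, l)) with he
  have hdvd : ∀ s m, (∏ l ∈ s, l ∣ 2 ^ m - 1 ↔ e s ∣ m) := by
    intro s m
    rw [he, orderOf_dvd_iff_pow_eq_one, ← ZMod.natCast_eq_zero_iff, Nat.cast_sub Nat.one_le_two_pow,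
      sub_eq_zero]
    push_cast
    rfl
  have hA : ∀ m ∈ Finset.Icc 1 M, (2 ^ m - 1).primeFactors ⊆ Q := by
    intro m hm l hl
    rw [Finset.mem_Icc] at hm
    rw [hQ, Finset.mem_range]
    have h1 := Nat.le_of_mem_primeFactors hl
    have h2 : 2 ^ m ≤ 2 ^ M := Nat.pow_le_pow_right (by norm_num) hm.2
    have h3 : 0 < 2 ^ m := by positivity
    omega
  rw [sum_prod_primeFactors_eq k (A := fun m => 2 ^ m - 1) (Finset.Icc 1 M) Q hA]
  set D := Q.powerset.filter fun s => 1 ≤ e s ∧ e s ≤ M ∧ ∀ l ∈ s, l.Prime with hD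
  have hterm : ∑ s ∈ Q.powerset, w s *
      ((Finset.Icc 1 M).filter fun m => s ⊆ (2 ^ m - 1).primeFactors).card ≤
      ∑ s ∈ D, w s * ((M : ℝ) / e s) := by
    rw [← Finset.sum_filter_add_sum_filter_not Q.powerset
      (fun s => 1 ≤ e s ∧ e s ≤ M ∧ ∀ l ∈ s, l.Prime), ← hD]
    have hz : ∑ s ∈ Q.powerset.filter (fun s => ¬ (1 ≤ e s ∧ e s ≤ M ∧ ∀ l ∈ s, l.Prime)), w s *
        ((Finset.Icc 1 M).filter fun m => s ⊆ (2 ^ m - 1).primeFactors).card = (0 : ℝ) := by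
      refine Finset.sum_eq_zero fun s hs => ?_
      rw [Finset.mem_filter] at hs
      rw [Finset.card_eq_zero.2, Nat.cast_zero, mul_zero]
      refine Finset.filter_eq_empty_iff.2 fun m hm hsub => hs.2 ?_
      rw [Finset.mem_Icc] at hm
      have hd := (hdvd s m).1 (prod_dvd_of_subset_primeFactors hsub)
      exact ⟨Nat.pos_of_dvd_of_pos hd hm.1, (Nat.le_of_dvd hm.1 hd).trans hm.2,
        fun l hl => Nat.prime_of_mem_primeFactors (hsub hl)⟩
    rw [hz, add_zero]
    refine Finset.sum_le_sum fun s _ => mul_le_mul_of_nonneg_left ?_ (hw0 s)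
    refine le_trans ?_ (card_filter_dvd_Icc_le (e s) M)
    exact_mod_cast Finset.card_le_card (Finset.monotone_filter_right _
      fun m _ hm => (hdvd s m).1 (prod_dvd_of_subset_primeFactors hm))
  refine hterm.trans ?_
  have hmaps : ∀ s ∈ D, Nat.log 2 (e s) ∈ Finset.range (M + 1) := by
    intro s hs
    rw [hD, Finset.mem_filter] at hs
    rw [Finset.mem_range, Nat.lt_succ_iff]
    exact (Nat.log_le_self 2 _).trans hs.2.2.1
  rw [← Finset.sum_fiberwise_of_maps_to hmaps]
  have hfib : ∀ j ∈ Finset.range (M + 1),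
      ∑ s ∈ D.filter (fun s => Nat.log 2 (e s) = j), w s * ((M : ℝ) / e s) ≤ β j * M := by
    intro j _
    set Nj := ∏ i ∈ Finset.Icc 1 (2 ^ (j + 1)), (2 ^ i - 1) with hNj
    have hNj0 : Nj ≠ 0 := by
      refine Finset.prod_ne_zero_iff.2 fun i hi => ?_
      have : 2 ^ 1 ≤ 2 ^ i := Nat.pow_le_pow_right (by norm_num) (Finset.mem_Icc.1 hi).1
      omega
    have hNjle : Nj ≤ 2 ^ 2 ^ (2 * j + 2) := by
      calc Nj ≤ ∏ i ∈ Finset.Icc 1 (2 ^ (j + 1)), 2 ^ (2 ^ (j + 1)) := by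
            refine Finset.prod_le_prod' fun i hi => (Nat.sub_le _ _).trans ?_
            exact Nat.pow_le_pow_right (by norm_num) (Finset.mem_Icc.1 hi).2
        _ = 2 ^ 2 ^ (2 * j + 2) := by
            rw [Finset.prod_const, Nat.card_Icc, ← pow_mul, Nat.add_sub_cancel]
            congr 1
            ring
    have hbound := prod_primeFactors_one_add_le (J := 2 * j + 2) (by omega) hNj0 hNjle k
    calc ∑ s ∈ D.filter (fun s => Nat.log 2 (e s) = j), w s * ((M : ℝ) / e s)
        ≤ ∑ s ∈ D.filter (fun s => Nat.log 2 (e s) = j), w s * (M * (1 / 2) ^ j) := by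
          refine Finset.sum_le_sum fun s hs => mul_le_mul_of_nonneg_left ?_ (hw0 s)
          rw [Finset.mem_filter, hD, Finset.mem_filter] at hs
          have h1 : 2 ^ j ≤ e s := by
            rw [← hs.2]
            exact Nat.pow_log_le_self 2 (by omega)
          have h2 : (2 : ℝ) ^ j ≤ e s := by exact_mod_cast h1
          rw [one_div, inv_pow, ← div_eq_mul_inv]
          gcongr
      _ = (∑ s ∈ D.filter (fun s => Nat.log 2 (e s) = j), w s) * (M * (1 / 2) ^ j) := by
          rw [Finset.sum_mul]
      _ ≤ (∑ s ∈ Nj.primeFactors.powerset, w s) * (M * (1 / 2) ^ j) := by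
          refine mul_le_mul_of_nonneg_right ?_ (by positivity)
          refine Finset.sum_le_sum_of_subset_of_nonneg ?_ fun s _ _ => hw0 s
          intro s hs
          rw [Finset.mem_filter, hD, Finset.mem_filter] at hs
          obtain ⟨⟨_, he1, _, hsp⟩, hlog⟩ := hs
          rw [Finset.mem_powerset]
          intro l hl
          rw [Nat.mem_primeFactors]
          refine ⟨hsp l hl, ?_, hNj0⟩
          refine (Finset.dvd_prod_of_mem (fun l => l) hl).trans
            (((hdvd s (e s)).2 dvd_rfl).trans ?_)
          refine Finset.dvd_prod_of_mem (fun i => 2 ^ i - 1) (Finset.mem_Icc.2 ⟨he1, ?_⟩)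
          rw [← hlog]
          exact (Nat.lt_pow_succ_log_self (by norm_num) _).le
      _ ≤ β j * M := by
          rw [← Finset.prod_one_add]
          refine (mul_le_mul_of_nonneg_right hbound (by positivity)).trans (le_of_eq ?_)
          simp only [hβ]
          ring
  refine (Finset.sum_le_sum hfib).trans ?_
  rw [← Finset.sum_mul]
  exact mul_le_mul_of_nonneg_right (hsum.sum_le_tsum _ fun j _ => hβ0 j) (Nat.cast_nonneg M)

theorem singularFactor_sq_le (n : ℕ) :
    singularFactor n ^ 2 ≤ ∏ l ∈ n.primeFactors, (1 + ((15 : ℕ) : ℝ) / l) := by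
  rw [singularFactor, ← Finset.prod_pow]
  refine Finset.prod_le_prod (fun l _ => by positivity) fun l hl => ?_
  have h1 : (1 : ℝ) ≤ l := by exact_mod_cast (Nat.prime_of_mem_primeFactors hl).one_le
  have h2 : (l : ℝ)⁻¹ ≤ 1 := inv_le_one_of_one_le₀ h1
  have h3 : 0 ≤ (l : ℝ)⁻¹ := by positivity
  rw [div_eq_mul_inv]
  push_cast
  set x := (l : ℝ)⁻¹
  have h4 : x ^ 2 ≤ x := by nlinarith
  have h5 : x ^ 3 ≤ x := by nlinarith
  have h6 : x ^ 4 ≤ x := by nlinarith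
  nlinarith

theorem exists_sum_singularFactor_mul_le :
    ∃ C : ℝ, 0 < C ∧ ∀ M : ℕ, ∑ m ∈ Finset.Icc 1 M,
      singularFactor m * singularFactor (2 ^ m - 1) ≤ C * M := by
  obtain ⟨C, hC⟩ := exists_sum_prod_primeFactors_two_pow_sub_one_le 15
  refine ⟨max C 0 + Real.exp (2 * (15 : ℕ)), by positivity, fun M => ?_⟩
  calc ∑ m ∈ Finset.Icc 1 M, singularFactor m * singularFactor (2 ^ m - 1)
      ≤ ∑ m ∈ Finset.Icc 1 M, (∏ l ∈ (2 ^ m - 1 : ℕ).primeFactors, (1 + ((15 : ℕ) : ℝ) / l) +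
          ∏ l ∈ m.primeFactors, (1 + ((15 : ℕ) : ℝ) / l)) := by
        refine Finset.sum_le_sum fun m _ => ?_
        have h1 := singularFactor_sq_le m
        have h2 := singularFactor_sq_le (2 ^ m - 1)
        nlinarith [sq_nonneg (singularFactor m - singularFactor (2 ^ m - 1)),
          sq_nonneg (singularFactor m), sq_nonneg (singularFactor (2 ^ m - 1))]
    _ ≤ (max C 0 + Real.exp (2 * (15 : ℕ))) * M := by
        rw [Finset.sum_add_distrib, add_mul]
        refine add_le_add ((hC M).trans ?_) (sum_prod_primeFactors_le 15 M)
        gcongr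
        exact le_max_left _ _

theorem one_le_prod_one_add_inv_sq (s : Finset ℕ) : (1 : ℝ) ≤ ∏ l ∈ s, (1 + (l : ℝ)⁻¹) ^ 2 := by
  have h : ∏ _l ∈ s, (1 : ℝ) ≤ ∏ l ∈ s, (1 + (l : ℝ)⁻¹) ^ 2 :=
    Finset.prod_le_prod (fun _ _ => zero_le_one) fun l _ => by
      have : (0 : ℝ) ≤ (l : ℝ)⁻¹ := by positivity
      exact one_le_pow₀ (by linarith)
  simpa using h

theorem one_le_singularFactor (n : ℕ) : 1 ≤ singularFactor n :=
  one_le_prod_one_add_inv_sq _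

theorem singularFactor_mono {m n : ℕ} (hmn : m ∣ n) (hn : n ≠ 0) :
    singularFactor m ≤ singularFactor n := by
  rw [singularFactor, singularFactor, ← Finset.prod_sdiff (Nat.primeFactors_mono hmn hn)]
  exact le_mul_of_one_le_left (Finset.prod_nonneg fun _ _ => by positivity)
    (one_le_prod_one_add_inv_sq _)

theorem singularFactor_mul_le {m n : ℕ} (hm : m ≠ 0) (hn : n ≠ 0) :
    singularFactor (m * n) ≤ singularFactor m * singularFactor n := by
  rw [singularFactor, singularFactor, singularFactor, Nat.primeFactors_mul hm hn,
    ← Finset.prod_union_inter]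
  exact le_mul_of_one_le_right (Finset.prod_nonneg fun _ _ => by positivity)
    (one_le_prod_one_add_inv_sq _)

theorem singularFactor_prime_pow_le {l : ℕ} (hl : l.Prime) (k : ℕ) :
    singularFactor (l ^ k) ≤ 9 / 4 := by
  rcases Nat.eq_zero_or_pos k with rfl | hk
  · norm_num [singularFactor]
  · rw [singularFactor, Nat.primeFactors_prime_pow hk.ne' hl, Finset.prod_singleton]
    have h2 : (2 : ℝ) ≤ l := by exact_mod_cast hl.two_le
    have h3 : (l : ℝ)⁻¹ ≤ 2⁻¹ := inv_anti₀ (by norm_num) h2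
    have h4 : (0 : ℝ) ≤ (l : ℝ)⁻¹ := by positivity
    nlinarith

theorem singularFactor_prime_pow_mul_le {l n : ℕ} (hl : l.Prime) (k : ℕ) (hn : n ≠ 0) :
    singularFactor (l ^ k * n) ≤ 9 / 4 * singularFactor n :=
  (singularFactor_mul_le (pow_ne_zero k hl.ne_zero) hn).trans <|
    mul_le_mul_of_nonneg_right (singularFactor_prime_pow_le hl k)
      (zero_le_one.trans (one_le_singularFactor n))

theorem singularFactor_prime_mul_le {l n : ℕ} (hl : l.Prime) (hn : n ≠ 0) :
    singularFactor (l * n) ≤ 9 / 4 * singularFactor n := by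
  simpa using singularFactor_prime_pow_mul_le hl 1 hn

theorem card_prime_solutions_le_of_pow_le {a b h z U : ℕ} {R : ℝ} (ha : 0 < a) (hb : 0 < b)
    (hab : a.Coprime b) (hh : 0 < h) (hz : 2 ≤ z) (hU : (U : ℝ) / b + 1 ≤ 2 * R)
    (hR : (z : ℝ) ^ 10 ≤ R) :
    (((Finset.range U).filter fun u => u.Prime ∧ z ^ 2 < u ∧
      ∃ v, v.Prime ∧ z ^ 2 < v ∧ a * u = b * v + h).card : ℝ) ≤
      10 * singularFactor (2 * a * b * h) * R / Real.log z ^ 2 := by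
  have hS := one_le_singularFactor (2 * a * b * h)
  have hz' : (2 : ℝ) ≤ z := by exact_mod_cast hz
  have hlog : 0 < Real.log z := Real.log_pos (by linarith)
  have hlog' : Real.log z ≤ z := Real.log_le_self (by linarith)
  have hR0 : 0 ≤ R := le_trans (by positivity) hR
  refine (card_prime_solutions_le ha hb hab hh hz).trans ?_
  rw [div_add' _ _ _ (by positivity)]
  refine div_le_div_of_nonneg_right ?_ (by positivity)
  set S := singularFactor (2 * a * b * h)
  have h1 : ((U : ℝ) / b + 1) * (4 * S) ≤ 2 * R * (4 * S) := by gcongr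
  have h2 : 2 * (z : ℝ) ^ 8 * Real.log z ^ 2 ≤ 2 * R := by
    have : Real.log z ^ 2 ≤ (z : ℝ) ^ 2 := by gcongr
    calc 2 * (z : ℝ) ^ 8 * Real.log z ^ 2 ≤ 2 * (z : ℝ) ^ 8 * (z : ℝ) ^ 2 := by gcongr
      _ = 2 * (z : ℝ) ^ 10 := by ring
      _ ≤ 2 * R := by linarith
  have h3 : R ≤ R * S := le_mul_of_one_le_right hR0 hS
  linarith

/-- The number of pairs of primes `(u, v)` with `a * u = b * v + h`, for primes `a, b ≤ y`
and `y ^ 2 < u ≤ y ^ 16 / (2 * a)`. -/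
theorem card_prime_solutions_le_of_primes {a b h y : ℕ} (ha : a.Prime) (hb : b.Prime)
    (hay : a ≤ y) (hby : b ≤ y) (hh : 0 < h) :
    (((Finset.range (y ^ 16 / (2 * a) + 1)).filter fun u => u.Prime ∧ y ^ 2 < u ∧
      ∃ v, v.Prime ∧ y ^ 2 < v ∧ a * u = b * v + h).card : ℝ) ≤
      120 * singularFactor h * (y : ℝ) ^ 16 / Real.log y ^ 2 *
        ((a : ℝ)⁻¹ * (b : ℝ)⁻¹ + if a = b then (a : ℝ)⁻¹ else 0) := by
  have hy2 : 2 ≤ y := ha.two_le.trans hay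
  have hy2' : (2 : ℝ) ≤ y := by exact_mod_cast hy2
  have ha0 : (1 : ℝ) ≤ a := by exact_mod_cast ha.one_le
  have hb0 : (1 : ℝ) ≤ b := by exact_mod_cast hb.one_le
  have hay' : (a : ℝ) ≤ y := by exact_mod_cast hay
  have hby' : (b : ℝ) ≤ y := by exact_mod_cast hby
  have hS := one_le_singularFactor h
  have hab : (a : ℝ) * b ≤ y ^ 2 := by nlinarith
  have hy4 : (4 : ℝ) ≤ (y : ℝ) ^ 2 := by nlinarith
  have hfloor : ((y ^ 16 / (2 * a) : ℕ) : ℝ) ≤ (y : ℝ) ^ 16 / (2 * a) := by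
    refine Nat.cast_div_le.trans (le_of_eq ?_)
    push_cast; rfl
  have hX : (y : ℝ) ^ 14 * (y : ℝ) ^ 2 = (y : ℝ) ^ 16 := by ring
  have hy10 : (y : ℝ) ^ 10 ≤ (y : ℝ) ^ 14 := pow_le_pow_right₀ (by linarith) (by norm_num)
  have hy14 : (y : ℝ) ^ 2 ≤ (y : ℝ) ^ 14 := pow_le_pow_right₀ (by linarith) (by norm_num)
  rcases eq_or_ne a b with rfl | hne
  · rw [if_pos rfl]
    by_cases hdvd : a ∣ h
    swap
    · rw [Finset.filter_false_of_mem]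
      · simp only [Finset.card_empty, Nat.cast_zero]
        positivity
      · rintro u - ⟨-, -, v, -, -, huv⟩
        exact hdvd ((Nat.dvd_add_right (dvd_mul_right a v)).1 (huv ▸ dvd_mul_right a u))
    obtain ⟨k, rfl⟩ := hdvd
    have hk : 0 < k := Nat.pos_of_mul_pos_left hh
    have hR : (y : ℝ) ^ 14 ≤ (y : ℝ) ^ 16 / a := by
      rw [le_div_iff₀ (by linarith), ← hX]
      gcongr
      nlinarith
    have hsimp : ∀ u v, a * u = a * v + a * k ↔ 1 * u = 1 * v + k := fun u v => by
      rw [← mul_add, Nat.mul_right_inj ha.ne_zero, one_mul, one_mul]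
    simp only [hsimp]
    refine (card_prime_solutions_le_of_pow_le (R := (y : ℝ) ^ 16 / a) one_pos one_pos
      (Nat.coprime_one_left 1) hk hy2 ?_ (hy10.trans hR)).trans ?_
    · push_cast
      have : (y : ℝ) ^ 16 / (2 * a) = (y : ℝ) ^ 16 / a / 2 := by ring
      linarith
    · have h1 : singularFactor (2 * 1 * 1 * k) ≤ 9 / 4 * singularFactor (a * k) := by
        rw [mul_one, mul_one]
        refine (singularFactor_prime_mul_le Nat.prime_two hk.ne').trans ?_
        gcongr
        exact singularFactor_mono (dvd_mul_left k a) hh.ne'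
      calc _ ≤ 10 * (9 / 4 * singularFactor (a * k)) * ((y : ℝ) ^ 16 / a) / Real.log y ^ 2 := by
            gcongr
        _ ≤ 120 * singularFactor (a * k) * (y : ℝ) ^ 16 / Real.log y ^ 2 * (a : ℝ)⁻¹ := by
            rw [← sub_nonneg]
            have : 0 ≤ (97.5 : ℝ) * (singularFactor (a * k) * (y : ℝ) ^ 16 / Real.log y ^ 2 *
              (a : ℝ)⁻¹) := by positivity
            refine this.trans (le_of_eq ?_)
            ring
        _ ≤ _ := by
            gcongr
            exact le_add_of_nonneg_left (by positivity)
  · rw [if_neg hne, add_zero]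
    have hR : (y : ℝ) ^ 14 ≤ (y : ℝ) ^ 16 / (a * b) := by
      rw [le_div_iff₀ (by positivity), ← hX]
      gcongr
    refine (card_prime_solutions_le_of_pow_le (R := (y : ℝ) ^ 16 / (a * b)) ha.pos hb.pos
      ((Nat.coprime_primes ha hb).2 hne) hh hy2 ?_ (hy10.trans hR)).trans ?_
    · have h1 : (((y ^ 16 / (2 * a) + 1 : ℕ) : ℝ)) / b ≤ (y : ℝ) ^ 16 / (a * b) / 2 + 1 := by
        rw [div_le_iff₀ (by linarith)]
        push_cast
        have : ((y : ℝ) ^ 16 / (a * b) / 2 + 1) * b = (y : ℝ) ^ 16 / (2 * a) + b := by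
          field_simp
        rw [this]
        linarith
      linarith
    · have h1 : singularFactor (2 * a * b * h) ≤
          9 / 4 * (9 / 4 * (9 / 4 * singularFactor h)) := by
        rw [mul_assoc, mul_assoc]
        refine (singularFactor_prime_mul_le Nat.prime_two
          (mul_ne_zero ha.ne_zero (mul_ne_zero hb.ne_zero hh.ne'))).trans ?_
        refine mul_le_mul_of_nonneg_left ?_ (by norm_num)
        refine (singularFactor_prime_mul_le ha (mul_ne_zero hb.ne_zero hh.ne')).trans ?_
        refine mul_le_mul_of_nonneg_left ?_ (by norm_num)
        exact singularFactor_prime_mul_le hb hh.ne'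
      have h2 : singularFactor (2 * a * b * h) ≤ 12 * singularFactor h := by linarith
      calc _ ≤ 10 * (12 * singularFactor h) * ((y : ℝ) ^ 16 / (a * b)) / Real.log y ^ 2 := by
            gcongr
        _ = _ := by
            rw [div_eq_mul_inv ((y : ℝ) ^ 16), mul_inv]
            ring

/-- The pairs of primes `p < q` in `(r ^ 2, K]`, weighted by the singular series of
`2 ^ q - 2 ^ p`. -/
theorem exists_sum_singularFactor_two_pow_sub_le :
    ∃ C : ℝ, 0 < C ∧ ∀ K r : ℕ, 2 ≤ r → r ^ 10 ≤ K → ∀ P : Finset ℕ,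
      (∀ p ∈ P, p ≤ K ∧ p.Prime ∧ r ^ 2 < p) →
      ∑ w ∈ (P ×ˢ P).filter (fun w => w.1 < w.2), singularFactor (2 ^ w.2 - 2 ^ w.1) ≤
        C * (K : ℝ) ^ 2 / Real.log r ^ 2 := by
  obtain ⟨C, hC0, hC⟩ := exists_sum_singularFactor_mul_le
  refine ⟨60 * C, by positivity, fun K r hr hrK P hP => ?_⟩
  have hmaps : ∀ w ∈ (P ×ˢ P).filter (fun w => w.1 < w.2), w.2 - w.1 ∈ Finset.Icc 1 K := by
    intro w hw
    rw [Finset.mem_filter, Finset.mem_product] at hw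
    have := (hP _ hw.1.2).1
    rw [Finset.mem_Icc]
    omega
  have hK : (2 : ℝ) ≤ K := by
    have : 2 ^ 10 ≤ r ^ 10 := Nat.pow_le_pow_left hr 10
    exact_mod_cast (by omega : 2 ≤ K)
  rw [← Finset.sum_fiberwise_of_maps_to hmaps]
  calc _ ≤ ∑ m ∈ Finset.Icc 1 K, 60 * (K : ℝ) / Real.log r ^ 2 *
        (singularFactor m * singularFactor (2 ^ m - 1)) := by
        refine Finset.sum_le_sum fun m hm => ?_
        have hm1 := (Finset.mem_Icc.1 hm).1
        set F := ((P ×ˢ P).filter (fun w => w.1 < w.2)).filter (fun w => w.2 - w.1 = m) with hF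
        have hFmem : ∀ w ∈ F, w.1 ∈ P ∧ w.2 ∈ P ∧ w.2 = w.1 + m := by
          intro w hw
          rw [hF, Finset.mem_filter, Finset.mem_filter, Finset.mem_product] at hw
          exact ⟨hw.1.1.1, hw.1.1.2, by omega⟩
        have hcard : (F.card : ℝ) ≤ 10 * singularFactor (2 * 1 * 1 * m) * K / Real.log r ^ 2 := by
          refine le_trans ?_ (card_prime_solutions_le_of_pow_le (U := K + 1) one_pos one_pos
            (Nat.coprime_one_left 1) hm1 hr ?_ (by exact_mod_cast hrK))
          · refine Nat.cast_le.2 (Finset.card_le_card_of_injOn (fun w => w.2) ?_ ?_)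
            · intro w hw
              obtain ⟨h1, h2, h3⟩ := hFmem w hw
              have h1' := hP _ h1
              have h2' := hP _ h2
              simp only [Finset.coe_filter, Finset.mem_range, Set.mem_ofPred_eq]
              exact ⟨by omega, h2'.2.1, h2'.2.2, w.1, h1'.2.1, h1'.2.2, by omega⟩
            · intro w hw w' hw' heq
              have h3 := (hFmem w hw).2.2
              have h3' := (hFmem w' hw').2.2
              simp only at heq
              exact Prod.ext (by omega) heq
          · push_cast
            linarith
        have hS2 : singularFactor (2 * 1 * 1 * m) ≤ 9 / 4 * singularFactor m := by
          rw [mul_one, mul_one]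
          exact singularFactor_prime_mul_le Nat.prime_two (by omega)
        have hS1 := one_le_singularFactor m
        have hSm := one_le_singularFactor (2 ^ m - 1)
        have hpow : 2 ^ 1 ≤ 2 ^ m := Nat.pow_le_pow_right (by norm_num) hm1
        calc ∑ w ∈ F, singularFactor (2 ^ w.2 - 2 ^ w.1)
            ≤ F.card • (9 / 4 * singularFactor (2 ^ m - 1)) := by
              refine Finset.sum_le_card_nsmul _ _ _ fun w hw => ?_
              rw [(hFmem w hw).2.2, pow_add, ← Nat.mul_sub_one]
              exact singularFactor_prime_pow_mul_le Nat.prime_two _ (by omega)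
          _ ≤ 10 * (9 / 4 * singularFactor m) * K / Real.log r ^ 2 *
                (9 / 4 * singularFactor (2 ^ m - 1)) := by
              rw [nsmul_eq_mul]
              gcongr
              exact hcard.trans (by gcongr)
          _ ≤ _ := by
              rw [← sub_nonneg]
              have : 0 ≤ (9.375 : ℝ) * (K / Real.log r ^ 2 *
                (singularFactor m * singularFactor (2 ^ m - 1))) := by positivity
              refine this.trans (le_of_eq ?_)
              ring
    _ ≤ 60 * (K : ℝ) / Real.log r ^ 2 * (C * K) := by
        rw [← Finset.mul_sum]
        exact mul_le_mul_of_nonneg_left (hC K) (by positivity)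
    _ = _ := by ring

theorem card_sq_le_card_image_mul {α β : Type*} [DecidableEq β] (T : Finset α) (f : α → β) :
    (T.card : ℝ) ^ 2 ≤
      (T.image f).card * ((T ×ˢ T).filter fun w => f w.1 = f w.2).card := by
  have h1 : (T.card : ℝ) = ∑ b ∈ T.image f, ((T.filter fun a => f a = b).card : ℝ) := by
    exact_mod_cast Finset.card_eq_sum_card_image f T
  have h2 : (((T ×ˢ T).filter fun w => f w.1 = f w.2).card : ℝ) =
      ∑ b ∈ T.image f, ((T.filter fun a => f a = b).card : ℝ) ^ 2 := by
    rw [Finset.card_eq_sum_card_fiberwise (f := fun w : α × α => f w.1) (t := T.image f)]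
    · push_cast
      refine Finset.sum_congr rfl fun b _ => ?_
      rw [sq, ← Nat.cast_mul, ← Finset.card_product]
      congr 2
      ext w
      simp only [Finset.mem_filter, Finset.mem_product]
      constructor
      · rintro ⟨⟨⟨h1, h2⟩, h3⟩, h4⟩
        exact ⟨⟨h1, h4⟩, h2, h3 ▸ h4⟩
      · rintro ⟨⟨h1, h2⟩, h3, h4⟩
        exact ⟨⟨⟨h1, h3⟩, h2.trans h4.symm⟩, h2⟩
    · intro w hw
      rw [Finset.mem_coe, Finset.mem_filter, Finset.mem_product] at hw
      exact Finset.mem_image_of_mem f hw.1.1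
  rw [h1, h2]
  exact sq_sum_le_card_mul_sum_sq

theorem card_filter_eq_le_card_add {α : Type*} (T : Finset (ℕ × α)) (f : ℕ × α → ℕ)
    (hf : ∀ s ∈ T, ∀ t ∈ T, s.1 = t.1 → f s = f t → s = t) :
    ((T ×ˢ T).filter fun w => f w.1 = f w.2).card ≤
      T.card + 2 * ((T ×ˢ T).filter fun w => w.1.1 < w.2.1 ∧ f w.1 = f w.2).card := by
  set A := (T ×ˢ T).filter fun w => w.1.1 < w.2.1 ∧ f w.1 = f w.2 with hA
  have hsub : (T ×ˢ T).filter (fun w => f w.1 = f w.2) ⊆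
      T.image (fun t => (t, t)) ∪ (A ∪ A.image Prod.swap) := by
    rintro ⟨s, t⟩ hw
    rw [Finset.mem_filter, Finset.mem_product] at hw
    obtain ⟨⟨hs, ht⟩, heq⟩ := hw
    simp only at hs ht heq
    rcases lt_trichotomy s.1 t.1 with h | h | h
    · refine Finset.mem_union_right _ (Finset.mem_union_left _ ?_)
      exact Finset.mem_filter.2 ⟨Finset.mk_mem_product hs ht, h, heq⟩
    · obtain rfl := hf s hs t ht h heq
      exact Finset.mem_union_left _ (Finset.mem_image_of_mem _ hs)
    · refine Finset.mem_union_right _ (Finset.mem_union_right _ ?_)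
      exact Finset.mem_image.2 ⟨(t, s),
        Finset.mem_filter.2 ⟨Finset.mk_mem_product ht hs, h, heq.symm⟩, rfl⟩
  have h1 := Finset.card_le_card hsub
  have h2 := Finset.card_union_le (T.image fun t => (t, t)) (A ∪ A.image Prod.swap)
  have h3 := Finset.card_union_le A (A.image Prod.swap)
  have h4 : (T.image fun t => (t, t)).card ≤ T.card := Finset.card_image_le
  have h5 : (A.image Prod.swap).card ≤ A.card := Finset.card_image_le
  omega

/-- Chebyshev's lower bound for the number of primes in `(M, N]`. -/
theorem div_log_sub_le_card_primes {N : ℕ} (hN : 4 ≤ N) (M : ℕ) :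
    (N : ℝ) / (4 * Real.log N) - M ≤
      ((Finset.range (N + 1)).filter fun p => p.Prime ∧ M < p).card := by
  have hN' : (4 : ℝ) ≤ N := by exact_mod_cast hN
  have hlog : 0 < Real.log N := Real.log_pos (by linarith)
  have h1 : (N : ℝ) / (4 * Real.log N) ≤ Nat.primeCounting N := by
    refine le_trans ?_ (Chebyshev.pi_ge N)
    rw [← div_div]
    refine div_le_div_of_nonneg_right ?_ hlog.le
    have h2 : Real.log ((N + 1) / 8) ≤ (N + 1) / 8 - 1 := Real.log_le_sub_one_of_pos (by positivity)
    rw [Real.log_div (by positivity) (by norm_num), show (8 : ℝ) = 2 ^ 3 by norm_num,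
      Real.log_pow] at h2
    have h3 := Real.log_two_gt_d9
    have h4 := Real.log_two_lt_d9
    push_cast at h2
    nlinarith
  have h2 : Nat.primeCounting N ≤
      ((Finset.range (N + 1)).filter fun p => p.Prime ∧ M < p).card + M := by
    rw [Nat.primeCounting, Nat.primeCounting', Nat.count_eq_card_filter_range]
    have hsub : (Finset.range (N + 1)).filter Nat.Prime ⊆
        ((Finset.range (N + 1)).filter fun p => p.Prime ∧ M < p) ∪ Finset.Icc 1 M := by
      intro p hp
      rw [Finset.mem_filter] at hp
      rw [Finset.mem_union, Finset.mem_filter, Finset.mem_Icc]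
      rcases lt_or_ge M p with h | h
      · exact Or.inl ⟨hp.1, hp.2, h⟩
      · exact Or.inr ⟨hp.2.one_le, h⟩
    refine (Finset.card_le_card hsub).trans ((Finset.card_union_le _ _).trans ?_)
    rw [Nat.card_Icc, Nat.add_sub_cancel]
  have h2' : (Nat.primeCounting N : ℝ) ≤
      ((Finset.range (N + 1)).filter fun p => p.Prime ∧ M < p).card + M := by exact_mod_cast h2
  linarith

/-- The pairs of primes `(a, u)` with `a ≤ y`, `y ^ 2 < u` and `2 * a * u ≤ y ^ 16`. -/
def semiprimePairs (y : ℕ) : Finset (ℕ × ℕ) :=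
  ((Finset.range (y + 1)).filter Nat.Prime ×ˢ Finset.range (y ^ 16 + 1)).filter fun w =>
    w.2.Prime ∧ y ^ 2 < w.2 ∧ 2 * w.1 * w.2 ≤ y ^ 16

theorem mem_semiprimePairs {y : ℕ} {w : ℕ × ℕ} (hw : w ∈ semiprimePairs y) :
    w.1.Prime ∧ w.1 ≤ y ∧ w.2.Prime ∧ y ^ 2 < w.2 ∧ 2 * w.1 * w.2 ≤ y ^ 16 := by
  rw [semiprimePairs, Finset.mem_filter, Finset.mem_product, Finset.mem_filter,
    Finset.mem_range] at hw
  exact ⟨hw.1.1.2, by omega, hw.2⟩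

theorem le_card_semiprimePairs {y : ℕ} (hy : 2 ≤ y) :
    (y : ℝ) ^ 16 / (512 * Real.log y) *
      ∑ a ∈ (Finset.range (y + 1)).filter Nat.Prime, (a : ℝ)⁻¹ ≤ (semiprimePairs y).card := by
  have hcard : (semiprimePairs y).card = ∑ a ∈ (Finset.range (y + 1)).filter Nat.Prime,
      ((Finset.range (y ^ 16 + 1)).filter fun u =>
        u.Prime ∧ y ^ 2 < u ∧ 2 * a * u ≤ y ^ 16).card := by
    simp only [semiprimePairs, Finset.card_filter, Finset.sum_product]
  rw [hcard, Finset.mul_sum]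
  push_cast
  refine Finset.sum_le_sum fun a ha => ?_
  rw [Finset.mem_filter, Finset.mem_range] at ha
  obtain ⟨hay, hap⟩ := ha
  have hy' : (2 : ℝ) ≤ y := by exact_mod_cast hy
  have ha1 : (1 : ℝ) ≤ a := by exact_mod_cast hap.one_le
  have hay' : (a : ℝ) ≤ y := by exact_mod_cast Nat.lt_succ_iff.1 hay
  have hlog : 0 < Real.log y := Real.log_pos (by linarith)
  have hlog' : Real.log y ≤ y := Real.log_le_self (by linarith)
  set N := y ^ 16 / (2 * a) with hN
  have hNle : N ≤ y ^ 16 := Nat.div_le_self _ _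
  have hsub : ((Finset.range (N + 1)).filter fun p => p.Prime ∧ y ^ 2 < p) ⊆
      (Finset.range (y ^ 16 + 1)).filter fun u => u.Prime ∧ y ^ 2 < u ∧ 2 * a * u ≤ y ^ 16 := by
    intro u hu
    rw [Finset.mem_filter, Finset.mem_range] at hu ⊢
    refine ⟨by omega, hu.2.1, hu.2.2, ?_⟩
    rw [mul_comm]
    exact (Nat.le_div_iff_mul_le (by have := hap.pos; omega)).1 (Nat.lt_succ_iff.1 hu.1)
  refine le_trans ?_ (Nat.cast_le.2 (Finset.card_le_card hsub))
  have hy15 : (2 : ℝ) ^ 15 ≤ (y : ℝ) ^ 15 := pow_le_pow_left₀ (by norm_num) hy' 15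
  have hR : (y : ℝ) ^ 15 ≤ (y : ℝ) ^ 16 / a := by
    rw [le_div_iff₀ (by linarith), pow_succ _ 15]
    gcongr
  have hNge : (y : ℝ) ^ 16 / (4 * a) ≤ N := by
    have h1 : (y : ℝ) ^ 16 / (2 * a) < N + 1 := by
      rw [div_lt_iff₀ (by positivity)]
      have h2 := Nat.lt_mul_div_succ (y ^ 16) (show 0 < 2 * a by have := hap.pos; omega)
      rw [mul_comm]
      exact_mod_cast h2
    have h2 : (y : ℝ) ^ 16 / (2 * a) = (y : ℝ) ^ 16 / a / 2 := by ring
    have h3 : (y : ℝ) ^ 16 / (4 * a) = (y : ℝ) ^ 16 / a / 4 := by ring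
    rw [h2] at h1
    rw [h3]
    linarith
  have hN4 : (4 : ℝ) ≤ N := by
    refine le_trans ?_ hNge
    have h3 : (y : ℝ) ^ 16 / (4 * a) = (y : ℝ) ^ 16 / a / 4 := by ring
    rw [h3]
    linarith
  refine le_trans ?_ (div_log_sub_le_card_primes (by exact_mod_cast hN4) (y ^ 2))
  have hlogN : Real.log N ≤ 16 * Real.log y := by
    have h1 : Real.log N ≤ Real.log ((y : ℝ) ^ 16) :=
      Real.log_le_log (by linarith) (by exact_mod_cast hNle)
    rw [Real.log_pow] at h1
    exact_mod_cast h1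
  have hlogN0 : 0 < Real.log N := Real.log_pos (by linarith)
  have h1 : (y : ℝ) ^ 16 / (256 * Real.log y) * (a : ℝ)⁻¹ ≤ N / (4 * Real.log N) := by
    calc (y : ℝ) ^ 16 / (256 * Real.log y) * (a : ℝ)⁻¹
        = (y : ℝ) ^ 16 / (4 * a) / (4 * (16 * Real.log y)) := by
          field_simp
          norm_num
      _ ≤ N / (4 * Real.log N) := by gcongr
  have h2 : (y : ℝ) ^ 2 ≤ (y : ℝ) ^ 16 / (512 * Real.log y) * (a : ℝ)⁻¹ := by
    rw [← div_eq_mul_inv, div_div, le_div_iff₀ (by positivity)]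
    have hy9 : (2 : ℝ) ^ 9 ≤ (y : ℝ) ^ 9 := pow_le_pow_left₀ (by norm_num) hy' 9
    calc (y : ℝ) ^ 2 * (512 * Real.log y * a) ≤ (y : ℝ) ^ 2 * ((y : ℝ) ^ 9 * y * y) := by
          gcongr
          linarith
      _ = (y : ℝ) ^ 13 := by ring
      _ ≤ (y : ℝ) ^ 16 := pow_le_pow_right₀ (by linarith) (by norm_num)
  have h3 : (y : ℝ) ^ 16 / (256 * Real.log y) * (a : ℝ)⁻¹ =
      2 * ((y : ℝ) ^ 16 / (512 * Real.log y) * (a : ℝ)⁻¹) := by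
    field_simp
    norm_num
  push_cast
  linarith

theorem log_log_le_sum_inv_primes {y : ℕ} (hy : 2 ≤ y) :
    Real.log (Real.log y / 2) ≤ ∑ a ∈ (Finset.range (y + 1)).filter Nat.Prime, (a : ℝ)⁻¹ := by
  have hlog : 0 < Real.log y := Real.log_pos (by exact_mod_cast hy)
  have h1 := log_le_mul_sum_primeSets y ∅
  rw [Finset.prod_empty, mul_one] at h1
  have h2 : ∑ s ∈ primeSets y ∅, ∏ l ∈ s, (l : ℝ)⁻¹ ≤
      ∏ a ∈ (Finset.range (y + 1)).filter Nat.Prime, (1 + 1 / (a : ℝ)) := by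
    rw [Finset.prod_one_add]
    simp only [one_div]
    refine Finset.sum_le_sum_of_subset_of_nonneg ?_ fun _ _ _ =>
      Finset.prod_nonneg fun _ _ => by positivity
    rw [primeSets, Finset.sdiff_empty]
    exact Finset.filter_subset _ _
  have h3 := prod_one_add_le_exp (s := (Finset.range (y + 1)).filter Nat.Prime) zero_le_one le_rfl
  rw [one_mul] at h3
  rw [Real.log_le_iff_le_exp (by positivity)]
  linarith

/-- The solutions of `2 ^ p + a * u = 2 ^ q + b * v` with `p < q`. -/
theorem exists_card_collisions_le :
    ∃ C : ℝ, 0 < C ∧ ∀ K r y : ℕ, 2 ≤ r → r ^ 10 ≤ K → 2 ≤ y → ∀ P : Finset ℕ,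
      (∀ p ∈ P, p ≤ K ∧ p.Prime ∧ r ^ 2 < p) →
      (((P ×ˢ semiprimePairs y) ×ˢ (P ×ˢ semiprimePairs y)).filter fun w =>
        w.1.1 < w.2.1 ∧ 2 ^ w.1.1 + w.1.2.1 * w.1.2.2 = 2 ^ w.2.1 + w.2.2.1 * w.2.2.2).card ≤
      C * (y : ℝ) ^ 16 / Real.log y ^ 2 * ((K : ℝ) ^ 2 / Real.log r ^ 2) *
        ((∑ a ∈ (Finset.range (y + 1)).filter Nat.Prime, (a : ℝ)⁻¹) ^ 2 +
          ∑ a ∈ (Finset.range (y + 1)).filter Nat.Prime, (a : ℝ)⁻¹) := by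
  obtain ⟨C, hC0, hC⟩ := exists_sum_singularFactor_two_pow_sub_le
  refine ⟨120 * C, by positivity, fun K r y hr hrK hy P hP => ?_⟩
  set S := (Finset.range (y + 1)).filter Nat.Prime with hS
  have hmemS : ∀ a ∈ S, a.Prime ∧ a ≤ y := fun a ha => by
    rw [hS, Finset.mem_filter, Finset.mem_range] at ha
    exact ⟨ha.2, by omega⟩
  set W := ∑ a ∈ S, (a : ℝ)⁻¹ with hW
  have hW0 : 0 ≤ W := Finset.sum_nonneg fun _ _ => by positivity
  set A := ((P ×ˢ semiprimePairs y) ×ˢ (P ×ˢ semiprimePairs y)).filter fun w =>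
    w.1.1 < w.2.1 ∧ 2 ^ w.1.1 + w.1.2.1 * w.1.2.2 = 2 ^ w.2.1 + w.2.2.1 * w.2.2.2 with hA
  have hmemA : ∀ w ∈ A, w.1.1 ∈ P ∧ w.1.2 ∈ semiprimePairs y ∧ w.2.1 ∈ P ∧
      w.2.2 ∈ semiprimePairs y ∧ w.1.1 < w.2.1 ∧
      2 ^ w.1.1 + w.1.2.1 * w.1.2.2 = 2 ^ w.2.1 + w.2.2.1 * w.2.2.2 := by
    intro w hw
    rw [hA, Finset.mem_filter, Finset.mem_product, Finset.mem_product, Finset.mem_product] at hw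
    exact ⟨hw.1.1.1, hw.1.1.2, hw.1.2.1, hw.1.2.2, hw.2⟩
  set D := (P ×ˢ P).filter (fun w => w.1 < w.2) with hD
  set g : ((ℕ × ℕ × ℕ) × (ℕ × ℕ × ℕ)) → (ℕ × ℕ) × (ℕ × ℕ) :=
    fun w => ((w.1.1, w.2.1), (w.1.2.1, w.2.2.1)) with hg
  have hmaps : ∀ w ∈ A, g w ∈ D ×ˢ (S ×ˢ S) := by
    intro w hw
    obtain ⟨h1, h2, h3, h4, h5, -⟩ := hmemA w hw
    have h2' := mem_semiprimePairs h2
    have h4' := mem_semiprimePairs h4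
    refine Finset.mk_mem_product (Finset.mem_filter.2 ⟨Finset.mk_mem_product h1 h3, h5⟩)
      (Finset.mk_mem_product (Finset.mem_filter.2 ⟨Finset.mem_range.2 ?_, h2'.1⟩)
        (Finset.mem_filter.2 ⟨Finset.mem_range.2 ?_, h4'.1⟩))
    · exact Nat.lt_succ_iff.2 h2'.2.1
    · exact Nat.lt_succ_iff.2 h4'.2.1
  rw [Finset.card_eq_sum_card_fiberwise hmaps, Finset.sum_product]
  push_cast
  have hsumS : ∑ ab ∈ S ×ˢ S, ((ab.1 : ℝ)⁻¹ * (ab.2 : ℝ)⁻¹ +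
      if ab.1 = ab.2 then (ab.1 : ℝ)⁻¹ else 0) = W ^ 2 + W := by
    rw [Finset.sum_add_distrib, Finset.sum_product, Finset.sum_product, sq, hW,
      Finset.sum_mul_sum]
    congr 1
    refine Finset.sum_congr rfl fun a ha => ?_
    rw [Finset.sum_ite_eq, if_pos ha]
  calc _ ≤ ∑ d ∈ D, ∑ ab ∈ S ×ˢ S,
        120 * singularFactor (2 ^ d.2 - 2 ^ d.1) * (y : ℝ) ^ 16 / Real.log y ^ 2 *
          ((ab.1 : ℝ)⁻¹ * (ab.2 : ℝ)⁻¹ + if ab.1 = ab.2 then (ab.1 : ℝ)⁻¹ else 0) := by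
        refine Finset.sum_le_sum fun d hd => Finset.sum_le_sum fun ab hab => ?_
        rw [Finset.mem_product] at hab
        have hd2 := (Finset.mem_filter.1 hd).2
        have hpow : 2 ^ d.1 < 2 ^ d.2 := Nat.pow_lt_pow_right (by norm_num) hd2
        refine le_trans ?_ (card_prime_solutions_le_of_primes (hmemS _ hab.1).1 (hmemS _ hab.2).1
          (hmemS _ hab.1).2 (hmemS _ hab.2).2 (Nat.sub_pos_of_lt hpow))
        refine Nat.cast_le.2 (Finset.card_le_card_of_injOn (fun w => w.1.2.2) ?_ ?_)
        · rintro ⟨⟨p, a, u⟩, q, b, v⟩ hw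
          rw [Finset.mem_coe, Finset.mem_filter] at hw
          obtain ⟨hwA, rfl, rfl⟩ : _ ∧ _ = d ∧ _ = ab := ⟨hw.1, Prod.mk.inj hw.2⟩
          obtain ⟨-, h2, -, h4, -, h6⟩ := hmemA _ hwA
          obtain ⟨h21, -, h23, h24, h25⟩ := mem_semiprimePairs h2
          obtain ⟨-, -, h43, h44, -⟩ := mem_semiprimePairs h4
          rw [Finset.mem_coe, Finset.mem_filter, Finset.mem_range, Nat.lt_succ_iff,
            Nat.le_div_iff_mul_le (Nat.mul_pos two_pos h21.pos), mul_comm]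
          simp only at h6 h25 hpow ⊢
          exact ⟨h25, h23, h24, v, h43, h44, by omega⟩
        · rintro ⟨⟨p, a, u⟩, q, b, v⟩ hw ⟨⟨p', a', u'⟩, q', b', v'⟩ hw' heq
          rw [Finset.mem_coe, Finset.mem_filter] at hw hw'
          obtain ⟨hwA, rfl, rfl⟩ : _ ∧ _ = d ∧ _ = ab := ⟨hw.1, Prod.mk.inj hw.2⟩
          have hw2 := hw'.2
          simp only [hg, Prod.mk.injEq] at hw2 heq
          obtain ⟨⟨rfl, rfl⟩, rfl, rfl⟩ := hw2
          obtain rfl := heq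
          obtain ⟨-, -, -, h4, -, h6⟩ := hmemA _ hwA
          obtain ⟨-, -, -, -, -, h6'⟩ := hmemA _ hw'.1
          simp only at h6 h6'
          have hb : 0 < b' := (mem_semiprimePairs h4).1.pos
          obtain rfl : v = v' := Nat.eq_of_mul_eq_mul_left hb (by omega)
          rfl
    _ = ∑ d ∈ D, singularFactor (2 ^ d.2 - 2 ^ d.1) *
          (120 * (y : ℝ) ^ 16 / Real.log y ^ 2 * (W ^ 2 + W)) := by
        refine Finset.sum_congr rfl fun d _ => ?_
        rw [← Finset.mul_sum, hsumS]
        ring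
    _ ≤ C * (K : ℝ) ^ 2 / Real.log r ^ 2 *
          (120 * (y : ℝ) ^ 16 / Real.log y ^ 2 * (W ^ 2 + W)) := by
        rw [← Finset.sum_mul]
        exact mul_le_mul_of_nonneg_right (hC K r hr hrK P hP) (by positivity)
    _ = _ := by ring

theorem eq_of_mul_eq_mul_of_mem_semiprimePairs {y : ℕ} {s t : ℕ × ℕ} (hs : s ∈ semiprimePairs y)
    (ht : t ∈ semiprimePairs y) (h : s.1 * s.2 = t.1 * t.2) : s = t := by
  obtain ⟨hs1, hsy, -, -, -⟩ := mem_semiprimePairs hs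
  obtain ⟨ht1, -, ht2, hty, -⟩ := mem_semiprimePairs ht
  have h1 : s.1 = t.1 := by
    rcases (Nat.Prime.dvd_mul hs1).1 (h ▸ dvd_mul_right s.1 s.2) with hd | hd
    · exact (Nat.prime_dvd_prime_iff_eq hs1 ht1).1 hd
    · have := (Nat.prime_dvd_prime_iff_eq hs1 ht2).1 hd
      nlinarith
  refine Prod.ext h1 (Nat.eq_of_mul_eq_mul_left hs1.pos ?_)
  rw [h, h1]

theorem exists_pow_le_lt_succ_pow {k : ℕ} (hk : k ≠ 0) (n : ℕ) :
    ∃ r : ℕ, r ^ k ≤ n ∧ n < (r + 1) ^ k := by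
  refine ⟨Nat.findGreatest (fun r => r ^ k ≤ n) n, ?_, ?_⟩
  · exact Nat.findGreatest_spec (P := fun r => r ^ k ≤ n) (Nat.zero_le n) (by simp [hk])
  · by_contra! h
    have hle : Nat.findGreatest (fun r => r ^ k ≤ n) n + 1 ≤ n :=
      (Nat.le_self_pow hk _).trans h
    exact Nat.findGreatest_is_greatest (P := fun r => r ^ k ≤ n) (Nat.lt_succ_self _) hle h

theorem log_le_of_lt_succ_pow {r k n : ℕ} (hr : 2 ≤ r) (hn : 0 < n) (h : n < (r + 1) ^ k) :
    Real.log n ≤ 2 * k * Real.log r := by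
  have h1 : n ≤ r ^ (2 * k) := by
    rw [pow_mul]
    exact h.le.trans (Nat.pow_le_pow_left (by nlinarith) k)
  have h2 : Real.log n ≤ Real.log ((r : ℝ) ^ (2 * k)) :=
    Real.log_le_log (by exact_mod_cast hn) (by exact_mod_cast h1)
  rw [Real.log_pow] at h2
  exact_mod_cast h2

theorem div_log_le_card_primes {r K : ℕ} (hr : 2 ≤ r) (hrK : r ^ 16 ≤ K)
    (hlog : Real.log K ≤ 32 * Real.log r) : (K : ℝ) / (8 * Real.log K) ≤
      ((Finset.range (K + 1)).filter fun p => p.Prime ∧ r ^ 2 < p).card := by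
  have hr' : (2 : ℝ) ≤ r := by exact_mod_cast hr
  have hK : 4 ≤ K := le_trans (by norm_num) ((Nat.pow_le_pow_left hr 16).trans hrK)
  have hlogK : 0 < Real.log K := Real.log_pos (by exact_mod_cast (by omega : 1 < K))
  refine le_trans ?_ (div_log_sub_le_card_primes hK (r ^ 2))
  have h1 : ((r ^ 2 : ℕ) : ℝ) ≤ K / (8 * Real.log K) := by
    have h2 : Real.log r ≤ r := Real.log_le_self (by linarith)
    have h3 : (2 : ℝ) ^ 13 ≤ (r : ℝ) ^ 13 := pow_le_pow_left₀ (by norm_num) hr' 13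
    rw [le_div_iff₀ (by positivity)]
    push_cast
    calc (r : ℝ) ^ 2 * (8 * Real.log K) ≤ (r : ℝ) ^ 2 * (8 * (32 * r)) := by
          gcongr
          linarith
      _ = 256 * (r : ℝ) ^ 3 := by ring
      _ ≤ (r : ℝ) ^ 13 * (r : ℝ) ^ 3 := by
          gcongr
          linarith
      _ ≤ K := by
          rw [← pow_add]
          exact_mod_cast hrK
  have h2 : (K : ℝ) / (4 * Real.log K) = 2 * (K / (8 * Real.log K)) := by
    field_simp
    norm_num
  linarith

theorem half_log_le_sum_inv_primes {K : ℕ} (hK : 16 ≤ K) : Real.log K / 2 ≤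
    ∑ a ∈ (Finset.range (2 ^ K + 1)).filter Nat.Prime, (a : ℝ)⁻¹ := by
  have hK' : (16 : ℝ) ≤ K := by exact_mod_cast hK
  have hl2 := Real.log_two_gt_d9
  have hlogK : 4 * Real.log 2 ≤ Real.log K := by
    have := Real.log_le_log (by norm_num) hK'
    rw [show (16 : ℝ) = 2 ^ 4 by norm_num, Real.log_pow] at this
    exact_mod_cast this
  refine le_trans ?_ (log_log_le_sum_inv_primes (Nat.le_self_pow (by omega) 2))
  have h1 : Real.log (K / 4) ≤ Real.log (Real.log (2 ^ K : ℕ) / 2) := by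
    refine Real.log_le_log (by positivity) ?_
    push_cast
    rw [Real.log_pow]
    nlinarith
  refine le_trans ?_ h1
  rw [Real.log_div (by positivity) (by norm_num), show (4 : ℝ) = 2 ^ 2 by norm_num, Real.log_pow]
  push_cast
  linarith

theorem card_bound_le {X K W Λ p v : ℝ} (hX : 0 ≤ X) (hK : 0 < K) (hW : 0 ≤ W) (hΛ : 0 < Λ)
    (hp : K / (8 * Λ) ≤ p) (hv : X / (512 * (K * Real.log 2)) * W ≤ v) :
    1 / 4096 * X * (W / Λ) ≤ p * v := by
  have h1 : Real.log 2 ≤ 1 := by linarith [Real.log_two_lt_d9]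
  have h2 : 0 < Real.log 2 := Real.log_pos one_lt_two
  have h3 : 0 ≤ p := le_trans (by positivity) hp
  calc 1 / 4096 * X * (W / Λ) = K / (8 * Λ) * (X / (512 * (K * 1)) * W) := by
        field_simp
        ring
    _ ≤ K / (8 * Λ) * (X / (512 * (K * Real.log 2)) * W) := by gcongr
    _ ≤ p * v := by gcongr

theorem energy_bound_le {C X K W Λ ρ : ℝ} (hC : 0 ≤ C) (hX : 0 ≤ X) (hK : 0 < K) (hW : 1 ≤ W)
    (hΛ : 0 < Λ) (hρ : Λ ≤ 32 * ρ) :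
    C * X / (K * Real.log 2) ^ 2 * (K ^ 2 / ρ ^ 2) * (W ^ 2 + W) ≤ 5000 * C * X * (W / Λ) ^ 2 := by
  have h1 : W ^ 2 + W ≤ 2 * W ^ 2 := by nlinarith
  have h2 : Λ / 32 ≤ ρ := by linarith
  have h3 : 2 / 3 ≤ Real.log 2 := by linarith [Real.log_two_gt_d9]
  calc C * X / (K * Real.log 2) ^ 2 * (K ^ 2 / ρ ^ 2) * (W ^ 2 + W)
      ≤ C * X / (K * (2 / 3)) ^ 2 * (K ^ 2 / (Λ / 32) ^ 2) * (2 * W ^ 2) := by gcongr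
    _ = 4608 * (C * X * (W / Λ) ^ 2) := by
        field_simp
        ring
    _ ≤ 5000 * (C * X * (W / Λ) ^ 2) := by
        gcongr
        norm_num
    _ = _ := by ring

theorem image_subset_filter {y : ℕ} {P : Finset ℕ} (hP : ∀ p ∈ P, p.Prime ∧ 2 ^ p ≤ y) :
    (P ×ˢ semiprimePairs y).image (fun t => 2 ^ t.1 + t.2.1 * t.2.2) ⊆
      (Finset.Icc 1 (y ^ 16)).filter
        (fun n => ∃ p q : ℕ, p.Prime ∧ P2star q ∧ n = 2 ^ p + q) := by
  intro n hn
  obtain ⟨⟨p, a, u⟩, ht, rfl⟩ := Finset.mem_image.1 hn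
  obtain ⟨hp, hau⟩ := Finset.mem_product.1 ht
  obtain ⟨ha, hay, hu, hyu, hle⟩ := mem_semiprimePairs hau
  obtain ⟨hpp, hpy⟩ := hP p hp
  simp only at ha hay hu hyu hle hpy ⊢
  rw [Finset.mem_filter, Finset.mem_Icc]
  refine ⟨⟨le_add_right Nat.one_le_two_pow, ?_⟩, p, a * u, hpp, Or.inr
    ⟨a, u, ha, hu, (Nat.pow_le_pow_left hay 2).trans_lt hyu, rfl⟩, rfl⟩
  have hy : 2 ≤ y := ha.two_le.trans hay
  have h1 : 2 * y ≤ y ^ 16 := by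
    calc 2 * y ≤ y * y := Nat.mul_le_mul_right y hy
      _ = y ^ 2 := (sq y).symm
      _ ≤ y ^ 16 := Nat.pow_le_pow_right (by omega) (by norm_num)
  have h2 : 2 * a * u = 2 * (a * u) := mul_assoc 2 a u
  omega

/-- If `t` points have at most `t + B * X * s ^ 2` coincidences under a map to a set of size `I`,
and `t` is at least `α * X * s`, then `I` is at least a constant times `X`. -/
theorem mul_le_of_sq_le_mul_energy {α B X s t I Q : ℝ} (hα : 0 < α) (hB : 0 ≤ B) (hX : 0 < X)
    (hs : 1 / 2 ≤ s) (ht : α * X * s ≤ t) (hQ : Q ≤ t + B * X * s ^ 2) (hI : 0 ≤ I)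
    (hCS : t ^ 2 ≤ I * Q) : α ^ 2 / (2 * α + B) * X ≤ I := by
  have hs0 : 0 < s := by linarith
  have hτ : 0 < α * X * s := by positivity
  have ht0 : 0 < t := hτ.trans_le ht
  have hE : 0 < t + B * X * s ^ 2 := by positivity
  have h1 : t ^ 2 ≤ I * (t + B * X * s ^ 2) := hCS.trans (mul_le_mul_of_nonneg_left hQ hI)
  have h2 : α * X ≤ 2 * t := by nlinarith [mul_pos hα hX]
  have h3 : (α * X * s) ^ 2 ≤ t ^ 2 := pow_le_pow_left₀ hτ.le ht 2
  have h4 : α ^ 2 * X * (t + B * X * s ^ 2) ≤ (2 * α + B) * t ^ 2 := by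
    have h5 := mul_le_mul_of_nonneg_left h3 hB
    have h6 := mul_le_mul_of_nonneg_left h2 (mul_pos hα ht0).le
    linarith
  rw [div_mul_eq_mul_div, div_le_iff₀ (by positivity)]
  refine le_of_mul_le_mul_right (h4.trans ?_) hE
  nlinarith

theorem exists_mul_two_pow_le_card :
    ∃ c : ℝ, 0 < c ∧ ∃ K₀ : ℕ, ∀ K : ℕ, K₀ ≤ K → c * (2 : ℝ) ^ (16 * K) ≤
      (((Finset.Icc 1 (2 ^ (16 * K))).filter
        (fun n => ∃ p q : ℕ, p.Prime ∧ P2star q ∧ n = 2 ^ p + q)).card : ℝ) := by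
  obtain ⟨C, hC0, hC⟩ := exists_card_collisions_le
  refine ⟨(1 / 4096) ^ 2 / (2 * (1 / 4096) + 10000 * C), by positivity, 2 ^ 16, fun K hK => ?_⟩
  obtain ⟨r, hrK, hKr⟩ := exists_pow_le_lt_succ_pow (k := 16) (by norm_num) K
  have hr2 : 2 ≤ r := by
    have := lt_of_pow_lt_pow_left' 16 (hK.trans_lt hKr)
    omega
  have hK' : (2 : ℝ) ^ 16 ≤ K := by exact_mod_cast hK
  have hK0 : (0 : ℝ) < K := lt_of_lt_of_le (by norm_num) hK'
  have hl2 := Real.log_two_gt_d9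
  set Λ := Real.log K with hΛ
  have hΛ16 : 16 * Real.log 2 ≤ Λ := by
    have := Real.log_le_log (by norm_num) hK'
    rw [Real.log_pow] at this
    exact_mod_cast this
  have hΛ0 : 0 < Λ := by linarith
  have hlogr : Λ ≤ 32 * Real.log r := by
    have := log_le_of_lt_succ_pow hr2 (by omega) hKr
    norm_num at this
    exact this
  obtain ⟨y, hy⟩ : ∃ y, y = 2 ^ K := ⟨_, rfl⟩
  have hy2 : 2 ≤ y := by
    rw [hy]
    exact Nat.le_self_pow (by omega) 2
  have hlogy : Real.log y = K * Real.log 2 := by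
    rw [hy]
    push_cast
    rw [Real.log_pow]
  have hX : (2 : ℝ) ^ (16 * K) = (y : ℝ) ^ 16 := by
    rw [hy]
    push_cast
    rw [← pow_mul, mul_comm]
  have hX' : 2 ^ (16 * K) = y ^ 16 := by rw [hy, ← pow_mul, mul_comm]
  set W := ∑ a ∈ (Finset.range (y + 1)).filter Nat.Prime, (a : ℝ)⁻¹ with hW
  have hWΛ : Λ / 2 ≤ W := by
    rw [hW, hy]
    exact half_log_le_sum_inv_primes (by omega)
  have hW1 : 1 ≤ W := by linarith
  set P := (Finset.range (K + 1)).filter fun p => p.Prime ∧ r ^ 2 < p with hP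
  have hmemP : ∀ p ∈ P, p ≤ K ∧ p.Prime ∧ r ^ 2 < p := fun p hp => by
    rw [hP, Finset.mem_filter, Finset.mem_range] at hp
    exact ⟨by omega, hp.2⟩
  have hcardP : (K : ℝ) / (8 * Λ) ≤ P.card := div_log_le_card_primes hr2 hrK hlogr
  have hcardV := le_card_semiprimePairs hy2
  rw [← hW, hlogy] at hcardV
  set T := P ×ˢ semiprimePairs y with hT
  set f : ℕ × ℕ × ℕ → ℕ := fun t => 2 ^ t.1 + t.2.1 * t.2.2 with hf
  have hcardT : 1 / 4096 * (2 : ℝ) ^ (16 * K) * (W / Λ) ≤ T.card := by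
    rw [hT, Finset.card_product, hX]
    push_cast
    exact card_bound_le (by positivity) hK0 (by linarith) hΛ0 hcardP hcardV
  have henergy : (((T ×ˢ T).filter fun w => f w.1 = f w.2).card : ℝ) ≤
      T.card + 10000 * C * (2 : ℝ) ^ (16 * K) * (W / Λ) ^ 2 := by
    have h1 := card_filter_eq_le_card_add T f fun s hs t ht hst hfst => by
      rw [hT, Finset.mem_product] at hs ht
      refine Prod.ext hst (eq_of_mul_eq_mul_of_mem_semiprimePairs hs.2 ht.2 ?_)
      simp only [hf, hst] at hfst
      omega
    have h2 := hC K r y hr2 ((Nat.pow_le_pow_right (by omega) (by norm_num)).trans hrK) hy2 P hmemP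
    rw [← hT, ← hW, ← hX, hlogy] at h2
    have h3 : C * (2 : ℝ) ^ (16 * K) / (K * Real.log 2) ^ 2 * ((K : ℝ) ^ 2 / Real.log r ^ 2) *
        (W ^ 2 + W) ≤ 5000 * C * (2 : ℝ) ^ (16 * K) * (W / Λ) ^ 2 :=
      energy_bound_le hC0.le (by positivity) hK0 hW1 hΛ0 hlogr
    have h1' : (((T ×ˢ T).filter fun w => f w.1 = f w.2).card : ℝ) ≤
        T.card + 2 * ((T ×ˢ T).filter fun w => w.1.1 < w.2.1 ∧ f w.1 = f w.2).card := by
      exact_mod_cast h1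
    linarith [h2.trans h3]
  have himage : T.image f ⊆ (Finset.Icc 1 (2 ^ (16 * K))).filter
      (fun n => ∃ p q : ℕ, p.Prime ∧ P2star q ∧ n = 2 ^ p + q) := by
    rw [hX']
    exact image_subset_filter fun p hp => ⟨(hmemP p hp).2.1,
      hy ▸ Nat.pow_le_pow_right (by norm_num) (hmemP p hp).1⟩
  refine (mul_le_of_sq_le_mul_energy (s := W / Λ) (by norm_num) (by positivity) (by positivity) ?_
    hcardT henergy (Nat.cast_nonneg _) (card_sq_le_card_image_mul T f)).trans
    (Nat.cast_le.2 (Finset.card_le_card himage))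
  rw [le_div_iff₀ hΛ0]
  linarith

/-- The sumset `2^𝒫 + P₂* = {2^p + q : p prime, q ∈ P₂*}` has positive lower
asymptotic density. -/
theorem romanov_P2star : ∃ c : ℝ, 0 < c ∧ ∃ x₀ : ℝ, ∀ x : ℝ, x₀ ≤ x →
    c * x ≤ (((Finset.Icc 1 ⌊x⌋₊).filter
      (fun n => ∃ p q : ℕ, p.Prime ∧ P2star q ∧ n = 2 ^ p + q)).card : ℝ) := by
  obtain ⟨c, hc, K₀, h⟩ := exists_mul_two_pow_le_card
  refine ⟨c / 2 ^ 16, by positivity, (2 ^ 16) ^ K₀, fun x hx => ?_⟩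
  have hN : (2 ^ 16) ^ K₀ ≤ ⌊x⌋₊ := Nat.le_floor (by exact_mod_cast hx)
  have hN0 : ⌊x⌋₊ ≠ 0 := by
    have : 0 < (2 ^ 16) ^ K₀ := by positivity
    omega
  set K := Nat.log (2 ^ 16) ⌊x⌋₊ with hK
  have hK₀ : K₀ ≤ K := Nat.le_log_of_pow_le (by norm_num) hN
  have hle : 2 ^ (16 * K) ≤ ⌊x⌋₊ := by
    rw [pow_mul]
    exact Nat.pow_log_le_self _ hN0
  have hlt : x ≤ 2 ^ 16 * (2 : ℝ) ^ (16 * K) := by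
    have h1 : ⌊x⌋₊ + 1 ≤ (2 ^ 16) ^ (K + 1) := Nat.lt_pow_succ_log_self (by norm_num) _
    rw [pow_succ, ← pow_mul, mul_comm] at h1
    have h2 : ((⌊x⌋₊ : ℝ) + 1) ≤ 2 ^ 16 * (2 : ℝ) ^ (16 * K) := by exact_mod_cast h1
    exact (Nat.lt_floor_add_one x).le.trans h2
  calc c / 2 ^ 16 * x ≤ c / 2 ^ 16 * (2 ^ 16 * (2 : ℝ) ^ (16 * K)) := by gcongr
    _ = c * (2 : ℝ) ^ (16 * K) := by
        rw [← mul_assoc, div_mul_cancel₀ _ (by norm_num)]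
    _ ≤ _ := h K hK₀
    _ ≤ _ := Nat.cast_le.2 (Finset.card_le_card (Finset.filter_subset_filter _
        (Finset.Icc_subset_Icc_right hle)))
end

section
/- There exist a constant c > 0 and x₀ such that for all real x ≥ x₀, the number of pairs (p, q) with p prime, q ∈ P₂*, and 2^p + q ≤ x is at least c·x. Equivalently, ∑_{n ≤ x} r(n) ≥ c·x, where r(n) = #{(p, q) : p prime, q ∈ P₂*, n = 2^p + q}. -/
open scoped Classical

/-- `r n` is the number of representations `n = 2 ^ p + q` with `p` prime and `q ∈ P₂*`. -/
noncomputable def r (n : ℕ) : ℕ :=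
  Set.ncard {pq : ℕ × ℕ | pq.1.Prime ∧ P2star pq.2 ∧ n = 2 ^ pq.1 + pq.2}

open Filter Nat in
/-- Chebyshev's lower bound for the prime counting function, with the constant `1 / 2`. -/
lemma eventually_div_two_mul_log_le_primeCounting :
    ∀ᶠ x : ℝ in atTop, x / (2 * Real.log x) ≤ primeCounting ⌊x⌋₊ := by
  have hlog := (Real.isLittleO_log_id_atTop).bound (show (0 : ℝ) < 1 / 10 by norm_num)
  filter_upwards [hlog, eventually_ge_atTop 100] with x hx hx100
  refine le_trans ?_ (Chebyshev.pi_ge' (by linarith))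
  have hlogpos : 0 < Real.log x := Real.log_pos (by linarith)
  rw [Real.norm_of_nonneg hlogpos.le, id, Real.norm_of_nonneg (by linarith)] at hx
  have h2 : Real.log (x + 2) ≤ Real.log 2 + Real.log x := by
    rw [← Real.log_mul (by norm_num) (by linarith)]
    exact Real.log_le_log (by linarith) (by linarith)
  rw [← div_div]
  gcongr
  nlinarith [Real.log_two_gt_d9, Real.log_two_lt_d9]

/-- A lower bound of Mertens type for the sum of the reciprocals of the primes. -/
lemma log_log_le_two_mul_sum_primesBelow_inv {N : ℕ} (hN : 2 ≤ N) :
    Real.log (Real.log N) ≤ 2 * ∑ p ∈ N.primesBelow, (p : ℝ)⁻¹ := by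
  let f : ℕ →* ℝ :=
    { toFun := fun n ↦ (n : ℝ)⁻¹, map_one' := by simp, map_mul' := by intro a b; simp [mul_comm] }
  have hf : ∀ n, f n = (n : ℝ)⁻¹ := fun _ ↦ rfl
  have hlt : ∀ {p : ℕ}, p.Prime → ‖f p‖ < 1 := fun {p} hp ↦ by
    rw [hf, norm_inv, Real.norm_natCast]
    exact inv_lt_one_of_one_lt₀ (mod_cast hp.one_lt)
  obtain ⟨hsum, hprod⟩ :=
    EulerProduct.summable_and_hasSum_smoothNumbers_prod_primesBelow_geometric hlt N
  have hNpos : (1 : ℝ) < N := mod_cast hN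
  have hharm : Real.log N ≤ ∏ p ∈ N.primesBelow, (1 - f p)⁻¹ := by
    have h1 := log_add_one_le_harmonic (N - 1)
    rw [harmonic_eq_sum_Icc, Nat.sub_add_cancel (by lia)] at h1
    push_cast at h1
    refine h1.trans ?_
    have hmem : ∀ n ∈ Finset.Icc 1 (N - 1), n ∈ N.smoothNumbers := fun n hn ↦ by
      rw [Finset.mem_Icc] at hn
      exact Nat.mem_smoothNumbers_of_lt (by lia) (by lia)
    have h2 := sum_le_hasSum ((Finset.Icc 1 (N - 1)).subtype (· ∈ N.smoothNumbers))
      (fun n _ ↦ (by rw [hf]; positivity : 0 ≤ f n)) hprod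
    rw [Finset.sum_subtype_of_mem (fun n ↦ f n) hmem] at h2
    exact h2
  calc Real.log (Real.log N) ≤ Real.log (∏ p ∈ N.primesBelow, (1 - f p)⁻¹) :=
        Real.log_le_log (Real.log_pos hNpos) hharm
    _ = ∑ p ∈ N.primesBelow, Real.log (1 - f p)⁻¹ := by
        refine Real.log_prod fun p hp ↦ ?_
        have := (le_abs_self _).trans_lt (hlt (Nat.prime_of_mem_primesBelow hp))
        exact inv_ne_zero (by linarith)
    _ ≤ ∑ p ∈ N.primesBelow, 2 * (p : ℝ)⁻¹ := by
        refine Finset.sum_le_sum fun p hp ↦ ?_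
        have h2 : (2 : ℝ) ≤ p := mod_cast Nat.two_le_of_mem_primesBelow hp
        have hp0 : (0 : ℝ) < p := by linarith
        have hp1 : (p : ℝ)⁻¹ ≤ 1 / 2 := by
          rw [one_div]; exact inv_anti₀ (by norm_num) h2
        have hpos : 0 < 1 - (p : ℝ)⁻¹ := by linarith
        refine (Real.log_le_sub_one_of_pos (by rw [hf]; positivity)).trans ?_
        rw [hf, sub_le_iff_le_add, inv_le_iff_one_le_mul₀ hpos]
        nlinarith [inv_pos.mpr hp0]
    _ = _ := by rw [Finset.mul_sum]

/-- The elements of `P₂*` not exceeding `N`. -/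
noncomputable def P2starUpTo (N : ℕ) : Finset ℕ := {n ∈ Finset.Icc 1 N | P2star n}

/-- Products `p * q ≤ N` with `p < M` and `M ^ 2 < q` are distinct elements of `P₂*`. -/
lemma sum_card_primes_le_card_P2starUpTo (M N : ℕ) :
    ∑ p ∈ M.primesBelow, ((N / p).primesLE \ (M ^ 2).primesLE).card ≤ (P2starUpTo N).card := by
  rw [← Finset.card_sigma]
  refine Finset.card_le_card_of_injOn (fun s ↦ s.1 * s.2) ?_ ?_
  · rintro ⟨p, q⟩ h
    simp only [Finset.coe_sigma, Set.mem_sigma_iff, Finset.mem_coe, Finset.mem_sdiff,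
      Nat.mem_primesLE, Nat.mem_primesBelow] at h
    obtain ⟨⟨hpM, hp⟩, ⟨hqN, hq⟩, hqM⟩ := h
    have hqM : M ^ 2 < q := by by_contra! h; exact hqM ⟨h, hq⟩
    simp only [P2starUpTo, Finset.coe_filter, Finset.mem_Icc, Set.mem_ofPred_eq]
    refine ⟨⟨Nat.mul_pos hp.pos hq.pos, ?_⟩, Or.inr ⟨p, q, hp, hq, ?_, rfl⟩⟩
    · rw [mul_comm]; exact (Nat.le_div_iff_mul_le hp.pos).mp hqN
    · exact lt_of_le_of_lt (Nat.pow_le_pow_left hpM.le 2) hqM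
  · rintro ⟨p, q⟩ h ⟨p', q'⟩ h' heq
    simp only [Finset.coe_sigma, Set.mem_sigma_iff, Finset.mem_coe, Finset.mem_sdiff,
      Nat.mem_primesLE, Nat.mem_primesBelow] at h h' heq
    obtain ⟨⟨hpM, hp⟩, ⟨-, hq⟩, hqM⟩ := h
    obtain ⟨⟨hpM', hp'⟩, ⟨-, hq'⟩, hqM'⟩ := h'
    have hqM' : M ^ 2 < q' := by by_contra! h; exact hqM' ⟨h, hq'⟩
    have hne : p ≠ q' := by nlinarith
    have hpp : p = p' := by
      have hdvd : p ∣ p' * q' := heq ▸ Dvd.intro _ rfl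
      rcases (hp.dvd_mul).mp hdvd with h | h
      · exact (Nat.prime_dvd_prime_iff_eq hp hp').mp h
      · exact absurd ((Nat.prime_dvd_prime_iff_eq hp hq').mp h) hne
    subst hpp
    have hqq : q = q' := Nat.eq_of_mul_eq_mul_left hp.pos heq
    subst hqq
    rfl

open Filter in
/-- The counting function of `P₂*` is at least of order `y log log y / log y`. -/
lemma eventually_le_card_P2starUpTo :
    ∀ᶠ y : ℝ in atTop, y * Real.log (Real.log y) / (32 * Real.log y)
      ≤ (P2starUpTo ⌊y⌋₊).card := by
  have hrpow : ∀ a : ℝ, 0 < a → Tendsto (fun y : ℝ ↦ y ^ a) atTop atTop :=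
    fun a ha ↦ tendsto_rpow_atTop ha
  obtain ⟨x₁, hx₁⟩ := eventually_atTop.mp eventually_div_two_mul_log_le_primeCounting
  have hlittle := (isLittleO_log_rpow_atTop (show (0 : ℝ) < 1 / 4 by norm_num)).bound
    (show (0 : ℝ) < 1 / 16 by norm_num)
  have hloglog := Real.tendsto_log_atTop.comp Real.tendsto_log_atTop
  filter_upwards [hlittle, eventually_ge_atTop 2,
    (hrpow (3 / 4) (by norm_num)).eventually_ge_atTop x₁,
    (hrpow (1 / 4) (by norm_num)).eventually_ge_atTop 2,
    hloglog.eventually_ge_atTop (2 * Real.log 4)] with y hy hy2 hyx₁ hy1 hll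
  simp only [Function.comp_apply] at hll
  have hy0 : 0 < y := by linarith
  set z : ℝ := y ^ (1 / 4 : ℝ) with hz
  have hz4 : z ^ 4 = y := by rw [hz, ← Real.rpow_natCast, ← Real.rpow_mul hy0.le]; norm_num
  have hz3 : y ^ (3 / 4 : ℝ) = z ^ 3 := by
    rw [hz, ← Real.rpow_natCast, ← Real.rpow_mul hy0.le]; norm_num
  rw [hz3] at hyx₁
  have hL : 0 < Real.log y := Real.log_pos (by linarith)
  rw [Real.norm_of_nonneg hL.le, Real.norm_of_nonneg (by linarith)] at hy
  set M : ℕ := ⌈z⌉₊ with hM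
  have hzM : z ≤ M := Nat.le_ceil z
  have hMz : (M : ℝ) < z + 1 := Nat.ceil_lt_add_one (by linarith)
  have hM2 : 2 ≤ M := by exact_mod_cast hy1.trans hzM
  have hterm : ∀ p ∈ M.primesBelow, y / (4 * Real.log y) * (p : ℝ)⁻¹ ≤
      (((⌊y⌋₊ / p).primesLE \ (M ^ 2).primesLE).card : ℝ) := fun p hp ↦ by
    have hpz : (p : ℝ) < z := Nat.lt_ceil.mp (Nat.lt_of_mem_primesBelow hp)
    have hp0 : (0 : ℝ) < p := mod_cast (Nat.prime_of_mem_primesBelow hp).pos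
    have hp1 : (1 : ℝ) ≤ p := mod_cast (Nat.prime_of_mem_primesBelow hp).one_le
    have hyp : z ^ 3 ≤ y / p := by
      rw [le_div_iff₀ hp0, ← hz4]
      nlinarith [pow_pos (show 0 < z by linarith) 3]
    have hz38 : (8 : ℝ) ≤ z ^ 3 := by nlinarith [mul_self_nonneg (z - 2)]
    have hcheb := hx₁ (y / p) (hyx₁.trans hyp)
    rw [Nat.floor_div_natCast] at hcheb
    have hlog : Real.log (y / p) ≤ Real.log y :=
      Real.log_le_log (by positivity) (div_le_self hy0.le hp1)
    have hlogpos : 0 < Real.log (y / p) := Real.log_pos (by linarith)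
    have hA : y / p / (2 * Real.log y) ≤ Nat.primeCounting (⌊y⌋₊ / p) :=
      le_trans (by gcongr) hcheb
    have hB : (Nat.primeCounting (M ^ 2) : ℝ) ≤ (M : ℝ) ^ 2 := by
      have : Nat.primeCounting (M ^ 2) ≤ M ^ 2 := by
        rw [← Nat.primesLE_card_eq_primeCounting, Nat.primesLE_eq_filter_Icc_one]
        exact (Finset.card_filter_le _ _).trans (by simp)
      exact_mod_cast this
    have hC : (Nat.primeCounting (⌊y⌋₊ / p) : ℝ) - Nat.primeCounting (M ^ 2) ≤
        (((⌊y⌋₊ / p).primesLE \ (M ^ 2).primesLE).card : ℝ) := by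
      rw [← Nat.primesLE_card_eq_primeCounting, ← Nat.primesLE_card_eq_primeCounting,
        sub_le_iff_le_add]
      have := Finset.le_card_sdiff (M ^ 2).primesLE (⌊y⌋₊ / p).primesLE
      exact_mod_cast (by lia)
    have hD : (M : ℝ) ^ 2 ≤ y / p / (4 * Real.log y) := by
      rw [le_div_iff₀ (by positivity)]
      refine le_trans ?_ hyp
      have : (M : ℝ) ^ 2 ≤ (2 * z) ^ 2 := by gcongr; linarith
      calc (M : ℝ) ^ 2 * (4 * Real.log y) ≤ (2 * z) ^ 2 * (4 * (1 / 16 * z)) := by gcongr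
        _ = z ^ 3 := by ring
    have hE : y / p / (2 * Real.log y) = 2 * (y / (4 * Real.log y) * (p : ℝ)⁻¹) := by
      field_simp; norm_num
    have hF : y / p / (4 * Real.log y) = y / (4 * Real.log y) * (p : ℝ)⁻¹ := by
      field_simp
    linarith
  have hlogM : Real.log (Real.log y) / 2 ≤ Real.log (Real.log M) := by
    have h1 : Real.log z = Real.log y / 4 := by rw [hz, Real.log_rpow hy0]; ring
    have h2 : Real.log (Real.log z) = Real.log (Real.log y) - Real.log 4 := by
      rw [h1, Real.log_div hL.ne' (by norm_num)]
    have h3 : Real.log (Real.log z) ≤ Real.log (Real.log M) :=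
      Real.log_le_log (Real.log_pos (by linarith)) (Real.log_le_log (by linarith) hzM)
    linarith
  have hmert := log_log_le_two_mul_sum_primesBelow_inv hM2
  calc y * Real.log (Real.log y) / (32 * Real.log y)
      ≤ y * Real.log (Real.log y) / (16 * Real.log y) := by
        have : 0 ≤ Real.log (Real.log y) := le_trans (by positivity) hll
        gcongr; norm_num
    _ = y / (4 * Real.log y) * (Real.log (Real.log y) / 4) := by field_simp; norm_num
    _ ≤ y / (4 * Real.log y) * ∑ p ∈ M.primesBelow, (p : ℝ)⁻¹ := by gcongr; linarith
    _ ≤ ∑ p ∈ M.primesBelow, (((⌊y⌋₊ / p).primesLE \ (M ^ 2).primesLE).card : ℝ) := by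
        rw [Finset.mul_sum]; exact Finset.sum_le_sum hterm
    _ ≤ _ := mod_cast sum_card_primes_le_card_P2starUpTo M ⌊y⌋₊

lemma finite_representations (n : ℕ) :
    {pq : ℕ × ℕ | pq.1.Prime ∧ P2star pq.2 ∧ n = 2 ^ pq.1 + pq.2}.Finite := by
  refine (Finset.Iic n ×ˢ Finset.Iic n).finite_toSet.subset ?_
  rintro ⟨p, q⟩ ⟨-, -, h⟩
  have := Nat.lt_two_pow_self (n := p)
  simp only [Finset.coe_product, Finset.coe_Iic, Set.mem_prod, Set.mem_Iic] at h ⊢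
  lia

lemma card_mul_card_le_sum_r {K L N : ℕ} (h : 2 ^ K + L ≤ N) :
    K.primesLE.card * (P2starUpTo L).card ≤ ∑ n ∈ Finset.Icc 1 N, r n := by
  rw [← Finset.card_product, Finset.card_eq_sum_card_fiberwise
    (f := fun pq : ℕ × ℕ ↦ 2 ^ pq.1 + pq.2) (t := Finset.Icc 1 N)]
  · refine Finset.sum_le_sum fun n _ ↦ ?_
    rw [r, ← Set.ncard_coe_finset]
    refine Set.ncard_le_ncard ?_ (finite_representations n)
    rintro ⟨p, q⟩ hpq
    simp only [P2starUpTo, Finset.coe_filter, Finset.mem_product, Nat.mem_primesLE,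
      Finset.mem_filter, Set.mem_ofPred_eq] at hpq
    exact ⟨hpq.1.1.2, hpq.1.2.2, hpq.2.symm⟩
  · rintro ⟨p, q⟩ hpq
    simp only [P2starUpTo, Finset.coe_product, Set.mem_prod, Finset.mem_coe, Nat.mem_primesLE,
      Finset.mem_filter, Finset.mem_Icc] at hpq
    have : 2 ^ p ≤ 2 ^ K := Nat.pow_le_pow_right (by norm_num) hpq.1.1
    simp only [Finset.coe_Icc, Set.mem_Icc]
    lia

/-- `∑_{n ≤ x} r(n) ≥ c x`, i.e. the number of pairs `(p, q)` with `p` prime,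
`q ∈ P₂*` and `2^p + q ≤ x` is at least `c·x` for sufficiently large `x`. -/
theorem sum_r_lower : ∃ c : ℝ, 0 < c ∧ ∃ x₀ : ℝ, ∀ x : ℝ, x₀ ≤ x →
    c * x ≤ ∑ n ∈ Finset.Icc 1 ⌊x⌋₊, (r n : ℝ) := by
  have hcheb := Real.tendsto_log_atTop.eventually eventually_div_two_mul_log_le_primeCounting
  have hloglog := Real.tendsto_log_atTop.comp Real.tendsto_log_atTop
  obtain ⟨y₀, hy₀⟩ := Filter.eventually_atTop.mp
    ((hcheb.and eventually_le_card_P2starUpTo).and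
      ((hloglog.eventually_gt_atTop 0).and (Filter.eventually_gt_atTop 1)))
  refine ⟨1 / 128, by norm_num, 2 * y₀, fun x hx ↦ ?_⟩
  obtain ⟨⟨hA, hB⟩, hll, hy1⟩ := hy₀ (x / 2) (by linarith)
  simp only [Function.comp_apply] at hll
  have hL : 0 < Real.log (x / 2) := Real.log_pos hy1
  set y := x / 2 with hy
  have hle : 2 ^ ⌊Real.log y⌋₊ + ⌊y⌋₊ ≤ ⌊x⌋₊ := by
    rw [Nat.le_floor_iff (by linarith)]
    push_cast
    have h1 : (2 : ℝ) ^ ⌊Real.log y⌋₊ ≤ y := by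
      calc (2 : ℝ) ^ ⌊Real.log y⌋₊ ≤ Real.exp 1 ^ ⌊Real.log y⌋₊ := by
            gcongr; linarith [Real.exp_one_gt_d9]
        _ = Real.exp ⌊Real.log y⌋₊ := by rw [← Real.exp_nat_mul, mul_one]
        _ ≤ Real.exp (Real.log y) := by gcongr; exact Nat.floor_le hL.le
        _ = y := Real.exp_log (by linarith)
    linarith [Nat.floor_le (show 0 ≤ y by linarith)]
  calc 1 / 128 * x = Real.log y / (2 * Real.log (Real.log y)) *
        (y * Real.log (Real.log y) / (32 * Real.log y)) := by
          rw [show x = 2 * y by rw [hy]; ring]; field_simp; norm_num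
    _ ≤ (⌊Real.log y⌋₊.primesLE.card : ℝ) * (P2starUpTo ⌊y⌋₊).card := by
        rw [Nat.primesLE_card_eq_primeCounting]
        gcongr
    _ ≤ _ := mod_cast card_mul_card_le_sum_r hle
end
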